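/- arXiv:1903.04867 — 4 statements merged into one kernel-verified Lean document; each statement's English description precedes it below -/
import Mathlib

section
/- Let G be a connected graph and ω a positive integer weight function on V(G). Then γ_ω(G) = max over v ∈ V(G) of Σ_{u ∈ V(G)} ω(u)·2^{d(u,v)}. -/
open SimpleGraph Finset

variable {V : Type*} [DecidableEq V]

/-- A single pebbling move: remove two pebbles from `u` and add one on an adjacent `v`. -/
def PebStep (G : SimpleGraph V) (D D' : V → ℕ) : Prop :=
  ∃ u v, G.Adj u v ∧ 2 ≤ D u ∧
    D' = fun x => if x = u then D u - 2 else if x = v then D v + 1 else D x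

/-- Reachability by a sequence of pebbling moves. -/
def PebReach (G : SimpleGraph V) : (V → ℕ) → (V → ℕ) → Prop :=
  Relation.ReflTransGen (PebStep G)

/-- `D` is `ω`-solvable: some sequence of pebbling moves reaches `D'` with `D' ≥ ω`. -/
def Solvable (G : SimpleGraph V) (ω D : V → ℕ) : Prop :=
  ∃ D', PebReach G D D' ∧ ∀ v, ω v ≤ D' v

/-- The `ω`-cover pebbling number: least `N` such that every distribution of
`N` pebbles is `ω`-solvable. -/
noncomputable def coverNum [Fintype V] (G : SimpleGraph V) (ω : V → ℕ) : ℕ :=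
  sInf {N | ∀ D : V → ℕ, (∑ v, D v) = N → Solvable G ω D}

/-- The `t`-pebbling number of a vertex `v`: least `N` such that from every
distribution of `N` pebbles one can move `t` pebbles onto `v`. -/
noncomputable def ftNum [Fintype V] (G : SimpleGraph V) (v : V) (t : ℕ) : ℕ :=
  sInf {N | ∀ D : V → ℕ, (∑ x, D x) = N → ∃ D', PebReach G D D' ∧ t ≤ D' v}

theorem PebStep.add_right {G : SimpleGraph V} {D D' : V → ℕ} (h : PebStep G D D') (X : V → ℕ) :
    PebStep G (D + X) (D' + X) := by
  obtain ⟨u, v, huv, h2, rfl⟩ := h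
  refine ⟨u, v, huv, by simp only [Pi.add_apply]; omega, ?_⟩
  funext x
  simp only [Pi.add_apply]
  split_ifs with h₁ h₂
  · subst h₁; omega
  · subst h₂; omega
  · rfl

theorem PebReach.add_right {G : SimpleGraph V} {D D' : V → ℕ} (h : PebReach G D D')
    (X : V → ℕ) : PebReach G (D + X) (D' + X) := by
  induction h with
  | refl => exact Relation.ReflTransGen.refl
  | tail _ h ih => exact ih.tail (h.add_right X)

theorem PebReach.add {G : SimpleGraph V} {D₁ D₁' D₂ D₂' : V → ℕ} (h₁ : PebReach G D₁ D₁')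
    (h₂ : PebReach G D₂ D₂') : PebReach G (D₁ + D₂) (D₁' + D₂') := by
  have h := h₂.add_right D₁'
  rw [add_comm D₂, add_comm D₂'] at h
  exact Relation.ReflTransGen.trans (h₁.add_right D₂) h

/-- Pebbles stacked on one vertex can be moved in pairs to a neighbour. -/
theorem pebReach_single {G : SimpleGraph V} {x y : V} (h : G.Adj y x) (k : ℕ) :
    PebReach G (Pi.single y (2 * k)) (Pi.single x k) := by
  induction k with
  | zero =>
    rw [mul_zero, Pi.single_zero, Pi.single_zero]
    exact Relation.ReflTransGen.refl
  | succ k ih =>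
    have h₁ : PebReach G (Pi.single y 2) (Pi.single x 1) := by
      refine Relation.ReflTransGen.single ⟨y, x, h, by simp, ?_⟩
      funext z
      have hne := h.ne
      by_cases hz : z = y
      · subst hz; simp [hne]
      · by_cases hx : z = x
        · subst hx; simp [hz]
        · simp [hz, hx]
    have h₂ := ih.add h₁
    rwa [← Pi.single_add, ← Pi.single_add] at h₂

/-- A solvable configuration has at least the potential of the goal, seen from any vertex. -/
theorem sum_mul_two_pow_dist_le_of_pebReach [Fintype V] {G : SimpleGraph V} (hG : G.Connected)
    (v : V) {D D' : V → ℕ} (h : PebReach G D D') :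
    ∑ u, D' u * 2 ^ G.dist u v ≤ ∑ u, D u * 2 ^ G.dist u v := by
  induction h with
  | refl => exact le_rfl
  | @tail B C _ h ih =>
    refine le_trans ?_ ih
    obtain ⟨a, b, hab, h2, rfl⟩ := h
    have hd : G.dist b v ≤ G.dist a v + 1 := by
      have h₁ := hG.dist_triangle (u := b) (v := a) (w := v)
      have h₂ : G.dist b a = 1 := SimpleGraph.dist_eq_one_iff_adj.2 hab.symm
      omega
    have hp : 2 ^ G.dist b v ≤ 2 * 2 ^ G.dist a v := by
      rw [← pow_succ']
      exact Nat.pow_le_pow_right (by norm_num) hd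
    have hb : b ∈ univ.erase a := by simp [hab.ne']
    rw [← add_sum_erase _ _ (mem_univ a), ← add_sum_erase _ _ (mem_univ a),
      ← add_sum_erase _ _ hb, ← add_sum_erase _ _ hb]
    have hrest : ∑ x ∈ (univ.erase a).erase b,
        (if x = a then B a - 2 else if x = b then B b + 1 else B x) * 2 ^ G.dist x v =
        ∑ x ∈ (univ.erase a).erase b, B x * 2 ^ G.dist x v := by
      refine sum_congr rfl fun x hx => ?_
      simp only [mem_erase, mem_univ, and_true] at hx
      rw [if_neg hx.2, if_neg hx.1]
    rw [hrest]
    simp only [if_true, if_neg hab.ne']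
    obtain ⟨m, hm⟩ := Nat.exists_eq_add_of_le h2
    rw [hm, Nat.add_sub_cancel_left]
    nlinarith

/-- Gathering surplus pebbles `e` from a set `A` of sources, all at distance `i = ℓ x` from `x`,
along geodesics that merge as early as possible: at most one pebble is stranded on each vertex of
a set `R` of intermediate vertices, and some source is joined by geodesics to few elements
of `R`. -/
theorem exists_gathering [Fintype V] {G : SimpleGraph V} (hG : G.Connected) (ℓ : V → ℕ)
    (hadj : ∀ x y, G.Adj x y → ℓ x ≤ ℓ y + 1) (e : V → ℕ) (i : ℕ) :
    ∀ x, ℓ x = i → ∀ A : Finset V, (∀ f ∈ A, (∀ u, ℓ u ≤ G.dist f u) ∧ G.dist f x = i) →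
      ∃ (R : Finset V) (k : ℕ),
        (∀ y ∈ R, ℓ y < i ∧ ℓ y + G.dist y x ≤ i ∧ ∃ f ∈ A, G.dist f y = ℓ y) ∧
        ∑ f ∈ A, e f ≤ k * 2 ^ i + ∑ y ∈ R, 2 ^ ℓ y ∧
        (∀ m ≤ k, ∃ c : V → ℕ, (∀ u ∉ A, c u = 0) ∧ (∀ u, c u ≤ e u) ∧
          ∑ u, c u = m * 2 ^ i ∧ PebReach G c (Pi.single x m)) ∧
        (A.Nonempty → ∃ v ∈ A, ∑ y ∈ R with G.dist v y = ℓ y, 2 ^ ℓ y < 2 ^ i) := by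
  have hempty : ∀ i x, ∃ (R : Finset V) (k : ℕ),
        (∀ y ∈ R, ℓ y < i ∧ ℓ y + G.dist y x ≤ i ∧ ∃ f ∈ (∅ : Finset V), G.dist f y = ℓ y) ∧
        ∑ f ∈ (∅ : Finset V), e f ≤ k * 2 ^ i + ∑ y ∈ R, 2 ^ ℓ y ∧
        (∀ m ≤ k, ∃ c : V → ℕ, (∀ u ∉ (∅ : Finset V), c u = 0) ∧ (∀ u, c u ≤ e u) ∧
          ∑ u, c u = m * 2 ^ i ∧ PebReach G c (Pi.single x m)) ∧
        ((∅ : Finset V).Nonempty →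
          ∃ v ∈ (∅ : Finset V), ∑ y ∈ R with G.dist v y = ℓ y, 2 ^ ℓ y < 2 ^ i) := by
    intro i x
    refine ⟨∅, 0, by simp, by simp, ?_, by simp⟩
    intro m hm
    obtain rfl : m = 0 := by omega
    refine ⟨0, by simp, by simp, by simp, ?_⟩
    rw [Pi.single_zero]
    exact Relation.ReflTransGen.refl
  induction i with
  | zero =>
    intro x hx A hA
    rcases A.eq_empty_or_nonempty with rfl | hne
    · exact hempty 0 x
    have hAx : A = {x} := by
      refine hne.subset_singleton_iff.1 fun f hf => ?_
      rw [mem_singleton]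
      exact hG.dist_eq_zero_iff.1 (hA f hf).2
    subst hAx
    refine ⟨∅, e x, by simp, by simp, fun m hm => ?_, by simp⟩
    refine ⟨Pi.single x m, ?_, ?_, by simp, Relation.ReflTransGen.refl⟩
    · intro u hu
      rw [mem_singleton] at hu
      simp [hu]
    · intro u
      by_cases hu : u = x
      · subst hu; simpa using hm
      · simp [hu]
  | succ i IH =>
    intro x hx A
    induction A using Finset.strongInduction with
    | H A ihA =>
    intro hA
    rcases A.eq_empty_or_nonempty with rfl | ⟨a, ha⟩
    · exact hempty (i + 1) x
    obtain ⟨y, hyx, hay⟩ : ∃ y, G.Adj y x ∧ G.dist a y = i := by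
      obtain ⟨q, hq⟩ := hG.exists_walk_length_eq_dist x a
      cases q with
      | nil =>
        have := (hA _ ha).2
        simp at this
      | @cons _ y _ h q =>
        refine ⟨y, h.symm, ?_⟩
        have h₁ := SimpleGraph.dist_le q
        have h₂ := (hA a ha).2
        have h₃ := hG.dist_triangle (u := x) (v := y) (w := a)
        have h₄ : G.dist x y = 1 := SimpleGraph.dist_eq_one_iff_adj.2 h
        rw [SimpleGraph.Walk.length_cons] at hq
        rw [SimpleGraph.dist_comm] at h₂ ⊢
        omega
    have hyx1 : G.dist y x = 1 := SimpleGraph.dist_eq_one_iff_adj.2 hyx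
    have hy : ℓ y = i := by
      have h₁ := (hA a ha).1 y
      have h₂ := hadj x y hyx.symm
      omega
    set A₁ := A.filter fun f => G.dist f y = i with hA₁
    set A₂ := A.filter fun f => ¬ G.dist f y = i with hA₂
    have haA₁ : a ∈ A₁ := mem_filter.2 ⟨ha, hay⟩
    have hss : A₂ ⊂ A := by
      refine ⟨filter_subset _ _, fun h => ?_⟩
      exact (mem_filter.1 (h ha)).2 hay
    obtain ⟨R₁, k₁, hR₁, hs₁, hm₁, hv₁⟩ := IH y hy A₁ fun f hf =>
      ⟨(hA f (mem_filter.1 hf).1).1, (mem_filter.1 hf).2⟩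
    obtain ⟨R₂, k₂, hR₂, hs₂, hm₂, hv₂⟩ := ihA A₂ hss fun f hf => hA f (mem_filter.1 hf).1
    have hyR₁ : y ∉ R₁ := fun h => by have := (hR₁ y h).1; omega
    have hR₁' : ∀ z ∈ insert y R₁, ℓ z ≤ i ∧ ℓ z + G.dist z y ≤ i ∧
        ∃ f ∈ A₁, G.dist f z = ℓ z := by
      intro z hz
      rcases mem_insert.1 hz with rfl | hz
      · exact ⟨hy.le, by simp [hy], a, haA₁, by rw [hay, hy]⟩
      · exact ⟨(hR₁ z hz).1.le, (hR₁ z hz).2⟩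
    have hfar : ∀ f ∈ A₂, ∀ z ∈ insert y R₁, G.dist f z ≠ ℓ z := by
      intro f hf z hz hfz
      have h₁ := (hR₁' z hz).2.1
      have h₂ := hG.dist_triangle (u := f) (v := z) (w := y)
      have h₃ := (hA f (mem_filter.1 hf).1).1 y
      exact (mem_filter.1 hf).2 (by omega)
    have hdisj : Disjoint (insert y R₁) R₂ := by
      rw [Finset.disjoint_left]
      intro z hz hz₂
      obtain ⟨f, hf, hfz⟩ := (hR₂ z hz₂).2.2
      exact hfar f hf z hz hfz
    refine ⟨insert y R₁ ∪ R₂, k₁ / 2 + k₂, ?_, ?_, ?_, ?_⟩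
    · intro z hz
      rcases mem_union.1 hz with hz | hz
      · obtain ⟨h₁, h₂, f, hf, hfz⟩ := hR₁' z hz
        have h₃ := hG.dist_triangle (u := z) (v := y) (w := x)
        exact ⟨by omega, by omega, f, (mem_filter.1 hf).1, hfz⟩
      · obtain ⟨h₁, h₂, f, hf, hfz⟩ := hR₂ z hz
        exact ⟨h₁, h₂, f, (mem_filter.1 hf).1, hfz⟩
    · rw [sum_union hdisj, sum_insert hyR₁, hy,
        ← sum_filter_add_sum_filter_not A (fun f => G.dist f y = i), ← hA₁, ← hA₂]
      have hk : k₁ * 2 ^ i ≤ (2 * (k₁ / 2) + 1) * 2 ^ i :=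
        Nat.mul_le_mul_right _ (by omega)
      rw [pow_succ] at hs₂ ⊢
      nlinarith
    · intro m hm
      obtain ⟨m₁, m₂, h₁, h₂, rfl⟩ : ∃ m₁ m₂, m₁ ≤ k₁ / 2 ∧ m₂ ≤ k₂ ∧ m = m₁ + m₂ :=
        ⟨min m (k₁ / 2), m - min m (k₁ / 2), by omega, by omega, by omega⟩
      obtain ⟨c₁, hc₁, hce₁, hcs₁, hcr₁⟩ := hm₁ (2 * m₁) (by omega)
      obtain ⟨c₂, hc₂, hce₂, hcs₂, hcr₂⟩ := hm₂ m₂ h₂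
      refine ⟨c₁ + c₂, ?_, ?_, ?_, ?_⟩
      · intro u hu
        have hu₁ : u ∉ A₁ := fun h => hu (mem_filter.1 h).1
        have hu₂ : u ∉ A₂ := fun h => hu (mem_filter.1 h).1
        simp [hc₁ u hu₁, hc₂ u hu₂]
      · intro u
        by_cases hu : G.dist u y = i
        · have hu₂ : u ∉ A₂ := fun h => (mem_filter.1 h).2 hu
          simpa [hc₂ u hu₂] using hce₁ u
        · have hu₁ : u ∉ A₁ := fun h => hu (mem_filter.1 h).2
          simpa [hc₁ u hu₁] using hce₂ u
      · simp only [Pi.add_apply, sum_add_distrib, hcs₁, hcs₂]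
        ring
      · rw [Pi.single_add]
        exact PebReach.add (hcr₁.trans (pebReach_single hyx m₁)) hcr₂
    · intro _
      rcases A₂.eq_empty_or_nonempty with h | h
      · have hR₂e : R₂ = ∅ := by
          refine eq_empty_of_forall_notMem fun z hz => ?_
          obtain ⟨f, hf, -⟩ := (hR₂ z hz).2.2
          simp [h] at hf
        obtain ⟨v, hv, hvs⟩ := hv₁ ⟨a, haA₁⟩
        refine ⟨v, (mem_filter.1 hv).1, ?_⟩
        rw [hR₂e, union_empty, filter_insert, if_pos (by rw [(mem_filter.1 hv).2, hy]),
          sum_insert (fun h => hyR₁ (mem_filter.1 h).1), hy, pow_succ]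
        omega
      · obtain ⟨v, hv, hvs⟩ := hv₂ h
        refine ⟨v, (mem_filter.1 hv).1, ?_⟩
        rw [filter_union, filter_eq_empty_iff.2 (fun {z} hz => hfar v hv z hz), empty_union]
        exact hvs

/-- `ℓ` is the distance to the set `F`. -/
def IsDistTo {W : Type*} (G : SimpleGraph W) (F : Finset W) (ℓ : W → ℕ) : Prop :=
  (∀ f ∈ F, ∀ u, ℓ u ≤ G.dist f u) ∧ ∀ u, ∃ f ∈ F, G.dist f u = ℓ u

theorem exists_isDistTo {W : Type*} (G : SimpleGraph W) {F : Finset W} (hF : F.Nonempty) :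
    ∃ ℓ, IsDistTo G F ℓ := by
  refine ⟨fun u => F.inf' hF fun f => G.dist f u, fun f hf u => inf'_le _ hf, fun u => ?_⟩
  obtain ⟨f, hf, h⟩ := exists_mem_eq_inf' hF fun f => G.dist f u
  exact ⟨f, hf, h.symm⟩

theorem mul_two_pow_add_two_pow_le {w a b : ℕ} (hw : 0 < w) (hab : a + 1 ≤ b) :
    w * 2 ^ a + 2 ^ a ≤ w * 2 ^ b :=
  calc w * 2 ^ a + 2 ^ a ≤ w * 2 ^ (a + 1) := by
        rw [pow_succ]
        nlinarith [Nat.mul_le_mul_right (2 ^ a) hw]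
    _ ≤ w * 2 ^ b := Nat.mul_le_mul_left _ (Nat.pow_le_pow_right (by norm_num) hab)

/-- A configuration is solvable as soon as its pebbles are accounted for by the surplus on a
nonempty set `F` and by the useful pebbles weighted by their distance to `F`. -/
theorem solvable_of_le_sum [Fintype V] {G : SimpleGraph V} (hG : G.Connected) {ω : V → ℕ}
    (hω : ∀ v, 0 < ω v) {N : ℕ} (hN : ∀ v, ∑ u, ω u * 2 ^ G.dist u v ≤ N) (n : ℕ) :
    ∀ (p : V → ℕ) (F : Finset V) (ℓ : V → ℕ), F.Nonempty → IsDistTo G F ℓ →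
      ∑ u, (ω u - p u) + #F = n →
      N ≤ ∑ u, min (p u) (ω u) * 2 ^ ℓ u + ∑ f ∈ F, (p f - ω f) → Solvable G ω p := by
  induction n using Nat.strong_induction_on with
  | h n IH =>
  intro p F ℓ hF hℓ hn hNp
  by_cases hT : ∀ v, ω v ≤ p v
  · exact ⟨p, Relation.ReflTransGen.refl, hT⟩
  obtain ⟨t, ht, htmin⟩ : ∃ t, p t < ω t ∧ ∀ u, ℓ u < ℓ t → ω u ≤ p u := by
    obtain ⟨t, ht, hmin⟩ := exists_min_image (univ.filter fun v => p v < ω v) ℓ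
      (by push Not at hT; obtain ⟨v, hv⟩ := hT; exact ⟨v, by simpa using hv⟩)
    refine ⟨t, (mem_filter.1 ht).2, fun u hu => ?_⟩
    by_contra! h
    have := hmin u (by simpa using h)
    omega
  have hadj : ∀ x y, G.Adj x y → ℓ x ≤ ℓ y + 1 := by
    intro x y hxy
    obtain ⟨f, hf, hfy⟩ := hℓ.2 y
    have h₁ := hℓ.1 f hf x
    have h₂ := hG.dist_triangle (u := f) (v := y) (w := x)
    have h₃ : G.dist y x = 1 := SimpleGraph.dist_eq_one_iff_adj.2 hxy.symm
    omega
  set A := F.filter fun f => G.dist f t = ℓ t with hA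
  obtain ⟨R, k, hR, hs, hm, hv⟩ := exists_gathering hG ℓ hadj (fun u => p u - ω u) (ℓ t) t rfl A
    fun f hf => ⟨hℓ.1 f (mem_filter.1 hf).1, (mem_filter.1 hf).2⟩
  have hAne : A.Nonempty := by
    obtain ⟨f, hf, hft⟩ := hℓ.2 t
    exact ⟨f, mem_filter.2 ⟨hf, hft⟩⟩
  have hRp : ∀ y ∈ R, min (p y) (ω y) = ω y := fun y hy => min_eq_right (htmin y (hR y hy).1)
  rcases Nat.eq_zero_or_pos k with rfl | hk
  · rw [zero_mul, zero_add] at hs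
    rcases (F.filter fun f => ¬ G.dist f t = ℓ t).eq_empty_or_nonempty with hB | hB
    · exfalso
      have hFA : F = A := by
        rw [hA, eq_comm, filter_eq_self]
        intro f hf
        by_contra h
        exact notMem_empty f (hB ▸ mem_filter.2 ⟨hf, h⟩)
      obtain ⟨v, hvA, hvs⟩ := hv hAne
      have hvF := (mem_filter.1 hvA).1
      have htR : t ∉ R := fun h => lt_irrefl _ (hR t h).1
      have key : ∑ u, (min (p u) (ω u) * 2 ^ ℓ u +
          ((if u ∈ R.filter (fun y => ¬ G.dist v y = ℓ y) then 2 ^ ℓ u else 0) +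
          if u = t then 2 ^ ℓ u else 0)) ≤ ∑ u, ω u * 2 ^ G.dist u v := by
        refine sum_le_sum fun u _ => ?_
        have hlu : ℓ u ≤ G.dist u v := by rw [SimpleGraph.dist_comm]; exact hℓ.1 v hvF u
        have hpow : 2 ^ ℓ u ≤ 2 ^ G.dist u v := Nat.pow_le_pow_right (by norm_num) hlu
        by_cases hut : u = t
        · subst hut
          rw [if_neg (fun h => htR (mem_filter.1 h).1), if_pos rfl, min_eq_left ht.le, zero_add,
            ← Nat.succ_mul]
          exact Nat.mul_le_mul ht hpow
        · rw [if_neg hut, add_zero]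
          split_ifs with huR
          · obtain ⟨huR, hne⟩ := mem_filter.1 huR
            rw [SimpleGraph.dist_comm] at hne
            rw [hRp u huR]
            exact mul_two_pow_add_two_pow_le (hω u) (by omega)
          · rw [add_zero]
            exact Nat.mul_le_mul (min_le_right _ _) hpow
      rw [sum_add_distrib, sum_add_distrib, sum_ite_mem, univ_inter, sum_ite_eq' univ t,
        if_pos (mem_univ t)] at key
      have h₁ := sum_filter_add_sum_filter_not R (fun y => G.dist v y = ℓ y) fun y => 2 ^ ℓ y
      have h₂ := hN v
      rw [hFA] at hNp
      omega
    · obtain ⟨ℓ', hℓ'⟩ := exists_isDistTo G hB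
      have hle : ∀ u, ℓ u ≤ ℓ' u := by
        intro u
        obtain ⟨f, hf, hfu⟩ := hℓ'.2 u
        exact hfu ▸ hℓ.1 f (mem_filter.1 hf).1 u
      have hlt : ∀ u ∈ R, ℓ u + 1 ≤ ℓ' u := by
        intro u hu
        obtain ⟨f, hf, hfu⟩ := hℓ'.2 u
        have h₁ := hℓ.1 f (mem_filter.1 hf).1 t
        have h₂ := (mem_filter.1 hf).2
        have h₃ := hG.dist_triangle (u := f) (v := u) (w := t)
        have h₄ := (hR u hu).2.1
        omega
      have hcard : #A + #(F.filter fun f => ¬ G.dist f t = ℓ t) = #F :=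
        card_filter_add_card_filter_not _
      have hApos := hAne.card_pos
      refine IH _ ?_ p _ ℓ' hB hℓ' rfl ?_
      · omega
      · have key : ∑ u, (min (p u) (ω u) * 2 ^ ℓ u + if u ∈ R then 2 ^ ℓ u else 0) ≤
            ∑ u, min (p u) (ω u) * 2 ^ ℓ' u := by
          refine sum_le_sum fun u _ => ?_
          split_ifs with hu
          · rw [hRp u hu]
            exact mul_two_pow_add_two_pow_le (hω u) (hlt u hu)
          · rw [add_zero]
            exact Nat.mul_le_mul_left _ (Nat.pow_le_pow_right (by norm_num) (hle u))
        rw [sum_add_distrib, sum_ite_mem, univ_inter] at key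
        have h₁ := sum_filter_add_sum_filter_not F (fun f => G.dist f t = ℓ t)
          fun f => p f - ω f
        rw [← hA] at h₁
        omega
  · obtain ⟨c, hcA, hce, hcs, hcr⟩ := hm 1 hk
    have hct : c t = 0 := by have := hce t; omega
    have hcF : ∑ f ∈ F, c f = 2 ^ ℓ t := by
      rw [← one_mul (2 ^ ℓ t), ← hcs]
      exact sum_subset (subset_univ F) fun u _ hu => hcA u fun h => hu (mem_filter.1 h).1
    have hreach : PebReach G p (Pi.single t 1 + (p - c)) := by
      have h := hcr.add_right (p - c)
      rwa [show c + (p - c) = p from funext fun u => by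
        have := hce u
        simp only [Pi.add_apply, Pi.sub_apply]; omega] at h
    have hval : ∀ u, (Pi.single t 1 + (p - c) : V → ℕ) u =
        if u = t then p t + 1 else p u - c u := by
      intro u
      by_cases hu : u = t
      · subst hu; simp [hct, add_comm]
      · simp [hu]
    generalize (Pi.single t 1 + (p - c) : V → ℕ) = q at hreach hval
    have hsol : Solvable G ω q := by
      refine IH _ ?_ q F ℓ hF hℓ rfl ?_
      · rw [← hn]
        refine Nat.add_lt_add_right (sum_lt_sum (fun u _ => ?_) ⟨t, mem_univ t, ?_⟩) _
        · rw [hval]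
          have := hce u
          split_ifs with hu
          · subst hu; omega
          · omega
        · rw [hval, if_pos rfl]
          omega
      · have h₁ : ∑ u, min (q u) (ω u) * 2 ^ ℓ u =
            ∑ u, min (p u) (ω u) * 2 ^ ℓ u + 2 ^ ℓ t := by
          rw [← add_sum_erase _ _ (mem_univ t), ← add_sum_erase _ _ (mem_univ t), hval,
            if_pos rfl, min_eq_left ht, min_eq_left ht.le, add_mul, one_mul, add_right_comm]
          congr 2
          refine sum_congr rfl fun u hu => ?_
          have := hce u
          rw [hval, if_neg (mem_erase.1 hu).1]
          congr 1
          omega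
        have h₂ : ∑ f ∈ F, (p f - ω f) = ∑ f ∈ F, (q f - ω f) + ∑ f ∈ F, c f := by
          rw [← sum_add_distrib]
          refine sum_congr rfl fun u _ => ?_
          have := hce u
          rw [hval]
          split_ifs with hu
          · subst hu; omega
          · omega
        omega
    obtain ⟨D', hD', hω'⟩ := hsol
    exact ⟨D', Relation.ReflTransGen.trans hreach hD', hω'⟩

/-- The `ω`-cover pebbling number of a connected graph with a positive weight
function equals `max_v Σ_u ω(u)·2^{d(u,v)}`. -/
theorem cover_pebbling_number_positive [Fintype V] (G : SimpleGraph V) (hG : G.Connected)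
    (ω : V → ℕ) (hω : ∀ v, 0 < ω v) :
    coverNum G ω = (Finset.univ.sup fun v => ∑ u, ω u * 2 ^ G.dist u v) := by
  have hmem : ∀ D : V → ℕ, (∑ v, D v) = (univ.sup fun v => ∑ u, ω u * 2 ^ G.dist u v) →
      Solvable G ω D := by
    intro D hD
    have : Nonempty V := hG.nonempty
    obtain ⟨ℓ, hℓ⟩ := exists_isDistTo G (univ_nonempty (α := V))
    refine solvable_of_le_sum hG hω (N := ∑ v, D v) (fun v => ?_) _ D univ ℓ univ_nonempty hℓ
      rfl ?_
    · rw [hD]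
      exact le_sup (f := fun v => ∑ u, ω u * 2 ^ G.dist u v) (mem_univ v)
    · rw [← sum_add_distrib]
      refine sum_le_sum fun u _ => ?_
      have : min (D u) (ω u) * 1 ≤ min (D u) (ω u) * 2 ^ ℓ u :=
        Nat.mul_le_mul_left _ Nat.one_le_two_pow
      omega
  refine le_antisymm (Nat.sInf_le hmem) (le_csInf ⟨_, hmem⟩ fun N hN => Finset.sup_le fun v _ => ?_)
  obtain ⟨D', hD', hω'⟩ := hN (Pi.single v N) (by simp)
  calc ∑ u, ω u * 2 ^ G.dist u v ≤ ∑ u, D' u * 2 ^ G.dist u v :=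
        sum_le_sum fun u _ => Nat.mul_le_mul_right _ (hω' u)
    _ ≤ ∑ u, (Pi.single v N : V → ℕ) u * 2 ^ G.dist u v :=
        sum_mul_two_pow_dist_le_of_pebReach hG v hD'
    _ = N := by simp [Pi.single_apply]
end

section
/- Let T be a tree and ω a nonnegative weight function on V(T) with γ_ω(T) ≥ 1. Then there exists a distribution D on T that is not ω-solvable, has |D| = γ_ω(T) − 1 pebbles, and places all its pebbles on leaves of T (i.e., D(v) = 0 for every vertex v with degree at least 2). -/
open SimpleGraph Finset

variable {V : Type*} [DecidableEq V]

set_option linter.unusedSectionVars false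

/-- A rooted tree structure given by sets of children; `rk` strictly decreases from a
vertex to its children and every vertex other than `root` has a unique parent. -/
structure ChildTree (V : Type*) where
  root : V
  ch : V → Finset V
  rk : V → ℕ
  rk_lt : ∀ {p c}, c ∈ ch p → rk c < rk p
  parent_unique : ∀ {p q c}, c ∈ ch p → c ∈ ch q → p = q
  root_notMem : ∀ p, root ∉ ch p
  exists_parent : ∀ v, v ≠ root → ∃ p, v ∈ ch p

/-- The net number of pebbles a branch with excess `h` contributes to the parent of its root. -/
def gain (h : ℤ) : ℤ := if 0 ≤ h then h / 2 else 2 * h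

lemma gain_mono {a b : ℤ} (hab : a ≤ b) : gain a ≤ gain b := by
  unfold gain; split_ifs <;> omega

lemma sum_add_of_eq_off_pair [Fintype V] {D D' : V → ℕ} {a b : V} (hab : a ≠ b)
    (hD : ∀ x, x ≠ a → x ≠ b → D' x = D x) :
    ∑ x, D' x + (D a + D b) = ∑ x, D x + (D' a + D' b) := by
  have hb : b ∈ univ.erase a := by simp [hab.symm]
  have key : ∑ x ∈ (univ.erase a).erase b, D' x = ∑ x ∈ (univ.erase a).erase b, D x :=
    sum_congr rfl fun x hx => hD x (by simp_all) (by simp_all)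
  rw [← add_sum_erase univ D' (mem_univ a), ← add_sum_erase univ D (mem_univ a),
    ← add_sum_erase _ D' hb, ← add_sum_erase _ D hb, key]
  omega

namespace ChildTree

variable (R : ChildTree V)

/-- The number of pebbles (possibly negative) at `v` in excess of its demand, once every branch
below `v` has been settled optimally. -/
def excess (ω D : V → ℕ) (v : V) : ℤ :=
  D v - ω v + ∑ c ∈ (R.ch v).attach, gain (excess ω D c.1)
termination_by R.rk v
decreasing_by exact R.rk_lt c.2

variable {R} {ω D D' : V → ℕ}

lemma excess_eq (v : V) :
    R.excess ω D v = D v - ω v + ∑ c ∈ R.ch v, gain (R.excess ω D c) := by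
  rw [excess, sum_attach (R.ch v) fun c => gain (R.excess ω D c)]

lemma excess_congr {x : V} (h : ∀ y, R.rk y ≤ R.rk x → D' y = D y) :
    R.excess ω D' x = R.excess ω D x := by
  induction hn : R.rk x using Nat.strong_induction_on generalizing x with
  | _ n ih =>
    subst hn
    rw [excess_eq, excess_eq, h x le_rfl]
    congr 1
    refine sum_congr rfl fun c hc => ?_
    have := R.rk_lt hc
    rw [ih _ this (fun y hy => h y (by omega)) rfl]

lemma excess_child {p c : V} (hc : c ∈ R.ch p) (hD : ∀ x, x ≠ p → x ≠ c → D' x = D x) :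
    R.excess ω D' c = R.excess ω D c + (D' c - D c) := by
  have hpc := R.rk_lt hc
  have key : ∑ b ∈ R.ch c, gain (R.excess ω D' b) = ∑ b ∈ R.ch c, gain (R.excess ω D b) := by
    refine sum_congr rfl fun b hb => ?_
    have hbc := R.rk_lt hb
    rw [excess_congr (D := D)]
    intro y hy
    exact hD y (by rintro rfl; omega) (by rintro rfl; omega)
  rw [excess_eq, excess_eq (D := D), key]
  ring

lemma excess_le_of_edge {p c : V} (hc : c ∈ R.ch p)
    (hD : ∀ x, x ≠ p → x ≠ c → D' x = D x)
    (h : (D' p : ℤ) - D p + gain (R.excess ω D c + (D' c - D c)) ≤ gain (R.excess ω D c))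
    {x : V} (hx : x ≠ c) : R.excess ω D' x ≤ R.excess ω D x := by
  induction hn : R.rk x using Nat.strong_induction_on generalizing x with
  | _ n ih =>
    subst hn
    rw [excess_eq, excess_eq (D := D)]
    by_cases hxp : x = p
    · subst hxp
      rw [← add_sum_erase _ _ hc, ← add_sum_erase _ (fun c => gain (R.excess ω D c)) hc,
        excess_child hc hD]
      have : ∑ b ∈ (R.ch x).erase c, gain (R.excess ω D' b) ≤
          ∑ b ∈ (R.ch x).erase c, gain (R.excess ω D b) := by
        refine sum_le_sum fun b hb => gain_mono ?_
        rw [mem_erase] at hb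
        exact ih _ (R.rk_lt hb.2) hb.1 rfl
      linarith
    · rw [hD x hxp hx]
      gcongr with b hb
      refine gain_mono (ih _ (R.rk_lt hb) ?_ rfl)
      rintro rfl
      exact hxp (R.parent_unique hb hc)

lemma ne_of_mem_ch {p c : V} (hc : c ∈ R.ch p) : p ≠ c := by
  rintro rfl
  exact lt_irrefl _ (R.rk_lt hc)

lemma ne_root_of_mem_ch {p c : V} (hc : c ∈ R.ch p) : R.root ≠ c := by
  rintro rfl
  exact R.root_notMem _ hc

section Solvability

variable {T : SimpleGraph V}

lemma excess_root_le_of_step (hR : ∀ u v, T.Adj u v ↔ v ∈ R.ch u ∨ u ∈ R.ch v)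
    (h : PebStep T D D') : R.excess ω D' R.root ≤ R.excess ω D R.root := by
  obtain ⟨u, v, huv, hu, rfl⟩ := h
  have hne := huv.ne
  rcases (hR u v).1 huv with hc | hc
  · refine excess_le_of_edge hc (fun x h1 h2 => by simp [h1, h2]) ?_ (ne_root_of_mem_ch hc)
    simp only [if_true, hne.symm, if_false]
    unfold gain; split_ifs <;> omega
  · refine excess_le_of_edge hc (fun x h1 h2 => by simp [h1, h2]) ?_ (ne_root_of_mem_ch hc)
    simp only [if_true, hne.symm, if_false]
    unfold gain; split_ifs <;> omega

lemma excess_nonneg_of_le (h : ∀ v, ω v ≤ D v) (x : V) : 0 ≤ R.excess ω D x := by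
  induction hn : R.rk x using Nat.strong_induction_on generalizing x with
  | _ n ih =>
    subst hn
    rw [excess_eq]
    have h1 := h x
    have : 0 ≤ ∑ c ∈ R.ch x, gain (R.excess ω D c) := by
      refine sum_nonneg fun c hc => ?_
      exact (gain_mono (ih _ (R.rk_lt hc) c rfl) : gain 0 ≤ _)
    omega

lemma excess_root_nonneg_of_solvable (hR : ∀ u v, T.Adj u v ↔ v ∈ R.ch u ∨ u ∈ R.ch v)
    (h : Solvable T ω D) : 0 ≤ R.excess ω D R.root := by
  obtain ⟨D', hreach, hD'⟩ := h
  induction hreach using Relation.ReflTransGen.head_induction_on with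
  | refl => exact excess_nonneg_of_le hD' _
  | head hstep _ ih => exact ih.trans (excess_root_le_of_step hR hstep)

/-- A configuration in which no move along an edge is worthwhile covers `ω`. -/
lemma le_of_no_useful_move [Fintype V] (hroot : 0 ≤ R.excess ω D R.root)
    (hup : ∀ p c, c ∈ R.ch p → 2 ≤ D c → R.excess ω D c < 2)
    (hdown : ∀ p c, c ∈ R.ch p → 2 ≤ D p → 0 ≤ R.excess ω D c) (v : V) : ω v ≤ D v := by
  have hle : ∀ c p, c ∈ R.ch p → R.excess ω D c ≤ 1 := by
    intro c
    induction hn : R.rk c using Nat.strong_induction_on generalizing c with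
    | _ n ih =>
      subst hn
      intro p hc
      by_cases hD : 2 ≤ D c
      · have := hup p c hc hD
        omega
      · rw [excess_eq]
        have : ∑ b ∈ R.ch c, gain (R.excess ω D b) ≤ 0 := by
          refine sum_nonpos fun b hb => ?_
          exact (gain_mono (ih _ (R.rk_lt hb) b rfl c hb) : _ ≤ gain 1)
        omega
  have hgain : ∀ x, ∀ c ∈ R.ch x, gain (R.excess ω D c) ≤ 0 := fun x c hc =>
    (gain_mono (hle c x hc) : _ ≤ gain 1)
  have hstep : ∀ x, 0 ≤ R.excess ω D x → ω x ≤ D x ∧ ∀ c ∈ R.ch x, 0 ≤ R.excess ω D c := by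
    intro x hx
    rw [excess_eq] at hx
    have hsum := sum_nonpos (hgain x)
    refine ⟨by omega, fun c hc => ?_⟩
    by_contra! hneg
    have hDx : ¬ 2 ≤ D x := fun h2 => absurd (hdown x c hc h2) (by omega)
    have h1 : ∑ b ∈ R.ch x, gain (R.excess ω D b) ≤ gain (R.excess ω D c) := by
      rw [← add_sum_erase _ _ hc]
      have := sum_nonpos fun b (hb : b ∈ (R.ch x).erase c) => hgain x b (mem_of_mem_erase hb)
      linarith
    have h2 : gain (R.excess ω D c) ≤ -2 :=
      (gain_mono (by omega : R.excess ω D c ≤ -1) : _ ≤ gain (-1))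
    omega
  have hall : ∀ x, 0 ≤ R.excess ω D x := by
    by_contra! hex
    obtain ⟨y, hy⟩ := hex
    obtain ⟨x, hx, hmax⟩ := exists_max_image (univ.filter fun x => R.excess ω D x < 0) R.rk
      ⟨y, by simpa using hy⟩
    simp only [mem_filter, mem_univ, true_and] at hx hmax
    have hxr : x ≠ R.root := by
      rintro rfl
      omega
    obtain ⟨p, hp⟩ := R.exists_parent x hxr
    by_cases hpos : 0 ≤ R.excess ω D p
    · have := (hstep p hpos).2 x hp
      omega
    · have h1 := hmax p (by omega)
      have h2 := R.rk_lt hp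
      omega
  exact (hstep v (hall v)).1

lemma solvable_of_excess_root_nonneg [Fintype V]
    (hR : ∀ u v, T.Adj u v ↔ v ∈ R.ch u ∨ u ∈ R.ch v)
    (h : 0 ≤ R.excess ω D R.root) : Solvable T ω D := by
  induction hn : ∑ x, D x using Nat.strong_induction_on generalizing D with
  | _ n ih =>
    subst hn
    have move : ∀ u v, T.Adj u v → 2 ≤ D u →
        (∀ D' : V → ℕ, D' u = D u - 2 → D' v = D v + 1 →
          (∀ x, x ≠ u → x ≠ v → D' x = D x) → R.excess ω D R.root ≤ R.excess ω D' R.root) →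
        Solvable T ω D := by
      intro u v huv hu hex
      have hne := huv.ne
      let D' : V → ℕ := fun x => if x = u then D u - 2 else if x = v then D v + 1 else D x
      have h1 : D' u = D u - 2 := by simp [D']
      have h2 : D' v = D v + 1 := by simp [D', hne.symm]
      have h3 : ∀ x, x ≠ u → x ≠ v → D' x = D x := fun x hx hx' => by simp [D', hx, hx']
      have hs := sum_add_of_eq_off_pair hne h3
      obtain ⟨E, hE, hωE⟩ := ih _ (by omega) (h.trans (hex D' h1 h2 h3)) rfl
      exact ⟨E, hE.head ⟨u, v, huv, hu, rfl⟩, hωE⟩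
    by_cases hup : ∃ p c, c ∈ R.ch p ∧ 2 ≤ D c ∧ 2 ≤ R.excess ω D c
    · obtain ⟨p, c, hc, hDc, hex⟩ := hup
      refine move c p ((hR _ _).2 (Or.inr hc)) hDc fun D' h1 h2 h3 => ?_
      have hch := excess_child (ω := ω) hc fun x hp hc => h3 x hc hp
      refine excess_le_of_edge hc (fun x hp hc => (h3 x hc hp).symm) ?_ (ne_root_of_mem_ch hc)
      rw [hch, h1, h2]
      unfold gain; split_ifs <;> omega
    by_cases hdown : ∃ p c, c ∈ R.ch p ∧ 2 ≤ D p ∧ R.excess ω D c < 0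
    · obtain ⟨p, c, hc, hDp, hex⟩ := hdown
      refine move p c ((hR _ _).2 (Or.inl hc)) hDp fun D' h1 h2 h3 => ?_
      have hch := excess_child (ω := ω) hc h3
      refine excess_le_of_edge hc (fun x hp hc => (h3 x hp hc).symm) ?_ (ne_root_of_mem_ch hc)
      rw [hch, h1, h2]
      unfold gain; split_ifs <;> omega
    push Not at hup hdown
    exact ⟨D, .refl, le_of_no_useful_move h hup hdown⟩

lemma solvable_iff [Fintype V] (hR : ∀ u v, T.Adj u v ↔ v ∈ R.ch u ∨ u ∈ R.ch v) :
    Solvable T ω D ↔ 0 ≤ R.excess ω D R.root :=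
  ⟨excess_root_nonneg_of_solvable hR, solvable_of_excess_root_nonneg hR⟩

end Solvability

section Leaves

variable [Fintype V]

/-- `D` puts no pebbles on those vertices of `S` that are neither the root nor childless. -/
def ClearOn (R : ChildTree V) (D : V → ℕ) (S : Finset V) : Prop :=
  ∀ x ∈ S, x ≠ R.root → (R.ch x).Nonempty → D x = 0

/-- A sufficiently large pile can be pushed down to a leaf without helping the root. -/
lemma exists_clearOn_of_large_pile {S : Finset V} (hS : ∀ x ∈ S, R.ch x ⊆ S) {x : V} (hx : x ∈ S)
    (hclear : R.ClearOn D (S.erase x)) (hxr : x ≠ R.root)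
    (hlarge : (R.ch x).Nonempty → 2 * (D x : ℤ) ≤ 3 * R.excess ω D x) :
    ∃ D' : V → ℕ, R.ClearOn D' S ∧ ∑ y, D' y = ∑ y, D y ∧
      R.excess ω D' R.root ≤ R.excess ω D R.root := by
  induction hn : R.rk x using Nat.strong_induction_on generalizing x D with
  | _ n ih =>
    subst hn
    by_cases hne : (R.ch x).Nonempty
    swap
    · refine ⟨D, fun y hy hyr hych => ?_, rfl, le_rfl⟩
      refine hclear y (mem_erase.2 ⟨?_, hy⟩) hyr hych
      rintro rfl
      exact hne hych
    have hl := hlarge hne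
    obtain ⟨c, hc, hcl⟩ : ∃ c ∈ R.ch x, -3 * R.excess ω D c ≤ D x := by
      by_contra! hcon
      have hneg : ∀ b ∈ R.ch x, gain (R.excess ω D b) ≤ 0 := fun b hb => by
        have := hcon b hb
        unfold gain; split_ifs <;> omega
      obtain ⟨c, hc⟩ := hne
      have h1 : ∑ b ∈ R.ch x, gain (R.excess ω D b) ≤ gain (R.excess ω D c) := by
        rw [← add_sum_erase _ _ hc]
        have := sum_nonpos fun b (hb : b ∈ (R.ch x).erase c) => hneg b (mem_of_mem_erase hb)
        linarith
      have h2 := hcon c hc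
      rw [excess_eq] at hl
      unfold gain at h1 hl; split_ifs at h1 <;> omega
    have hxc := ne_of_mem_ch hc
    have hcS := hS x hx hc
    let D₁ : V → ℕ := fun y => if y = x then 0 else if y = c then D c + D x else D y
    have hD₁x : D₁ x = 0 := by simp [D₁]
    have hD₁c : D₁ c = D c + D x := by simp [D₁, hxc.symm]
    have hD₁ : ∀ y, y ≠ x → y ≠ c → D₁ y = D y := fun y h1 h2 => by simp [D₁, h1, h2]
    have hroot : R.excess ω D₁ R.root ≤ R.excess ω D R.root := by
      refine excess_le_of_edge hc hD₁ ?_ (ne_root_of_mem_ch hc)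
      rw [hD₁x, hD₁c]
      unfold gain; split_ifs <;> omega
    have hsum := sum_add_of_eq_off_pair hxc hD₁
    obtain ⟨D', h1, h2, h3⟩ := ih _ (R.rk_lt hc) (D := D₁) hcS
      (by
        intro y hy hyr hych
        rw [mem_erase] at hy
        by_cases hyx : y = x
        · rw [hyx, hD₁x]
        · rw [hD₁ y hyx hy.1]
          exact hclear y (mem_erase.2 ⟨hyx, hy.2⟩) hyr hych)
      (ne_root_of_mem_ch hc).symm
      (by
        intro hcch
        have hDc := hclear c (mem_erase.2 ⟨hxc.symm, hcS⟩) (ne_root_of_mem_ch hc).symm hcch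
        rw [excess_child hc hD₁, hD₁c, hDc]
        push_cast
        omega) rfl
    exact ⟨D', h1, by omega, h3.trans hroot⟩

lemma exists_clearOn (ω D : V → ℕ) (S : Finset V) (hS : ∀ x ∈ S, R.ch x ⊆ S) :
    ∃ D' : V → ℕ, R.ClearOn D' S ∧ ∑ y, D' y = ∑ y, D y ∧
      R.excess ω D' R.root ≤ R.excess ω D R.root := by
  induction S using Finset.induction_on_max_value R.rk with
  | empty => exact ⟨D, fun x hx => by simp at hx, rfl, le_rfl⟩
  | insert v S hv hmax ih =>
    obtain ⟨D₁, hclear, hsum, hexc⟩ := ih fun x hx c hc => by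
      have h1 := R.rk_lt hc
      have h2 := hmax x hx
      refine (mem_insert.1 (hS x (mem_insert_of_mem hx) hc)).resolve_left ?_
      rintro rfl
      omega
    suffices ∃ D' : V → ℕ, R.ClearOn D' (insert v S) ∧ ∑ y, D' y = ∑ y, D₁ y ∧
        R.excess ω D' R.root ≤ R.excess ω D₁ R.root by
      obtain ⟨D', h1, h2, h3⟩ := this
      exact ⟨D', h1, h2.trans hsum, h3.trans hexc⟩
    by_cases hvr : v = R.root
    · refine ⟨D₁, fun x hx hxr hch => ?_, rfl, le_rfl⟩
      exact hclear x ((mem_insert.1 hx).resolve_left (by rintro rfl; exact hxr hvr)) hxr hch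
    by_cases hlarge : (R.ch v).Nonempty → 2 * (D₁ v : ℤ) ≤ 3 * R.excess ω D₁ v
    · exact exists_clearOn_of_large_pile hS (mem_insert_self v S)
        (by rwa [erase_insert hv]) hvr hlarge
    push Not at hlarge
    obtain ⟨p, hp⟩ := R.exists_parent v hvr
    have hpv := ne_of_mem_ch hp
    have hrk := R.rk_lt hp
    let D₂ : V → ℕ := fun y => if y = v then 0 else if y = p then D₁ p + D₁ v else D₁ y
    have hv₂ : D₂ v = 0 := by simp [D₂]
    have hp₂ : D₂ p = D₁ p + D₁ v := by simp [D₂, hpv]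
    have hD₂ : ∀ y, y ≠ p → y ≠ v → D₂ y = D₁ y := fun y h1 h2 => by simp [D₂, h1, h2]
    have hs := sum_add_of_eq_off_pair hpv hD₂
    refine ⟨D₂, fun x hx hxr hch => ?_, by omega, ?_⟩
    · by_cases hxv : x = v
      · rw [hxv, hv₂]
      have hxS := (mem_insert.1 hx).resolve_left hxv
      have := hmax x hxS
      rw [hD₂ x (by rintro rfl; omega) hxv]
      exact hclear x hxS hxr hch
    · refine excess_le_of_edge hp hD₂ ?_ (ne_root_of_mem_ch hp)
      rw [hv₂, hp₂]
      unfold gain; split_ifs <;> omega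

end Leaves

end ChildTree

/-- A finite tree can be rooted at any vertex `r`. -/
lemma SimpleGraph.IsTree.exists_rooting [Fintype V] {T : SimpleGraph V} (hT : T.IsTree)
    (r : V) : ∃ R : ChildTree V, R.root = r ∧ ∀ u v, T.Adj u v ↔ v ∈ R.ch u ∨ u ∈ R.ch v := by
  classical
  have hle : ∀ v, T.dist r v ≤ ∑ x, T.dist r x := fun v =>
    single_le_sum (f := fun x => T.dist r x) (fun _ _ => Nat.zero_le _) (mem_univ v)
  refine ⟨{ root := r
            ch := fun v => univ.filter fun c => T.Adj v c ∧ T.dist r c = T.dist r v + 1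
            rk := fun v => ∑ x, T.dist r x - T.dist r v
            rk_lt := ?_
            parent_unique := ?_
            root_notMem := by simp
            exists_parent := ?_ }, rfl, ?_⟩
  · intro p c hc
    have h1 := hle c
    simp only [mem_filter] at hc
    omega
  · intro p q c hp hq
    simp only [mem_filter, mem_univ, true_and] at hp hq
    obtain ⟨P, hP⟩ := hT.connected.exists_walk_length_eq_dist r p
    obtain ⟨Q, hQ⟩ := hT.connected.exists_walk_length_eq_dist r q
    have hPc : (P.concat hp.1).IsPath :=
      (P.concat hp.1).isPath_of_length_eq_dist (by rw [Walk.length_concat, hP, hp.2])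
    have hQc : (Q.concat hq.1).IsPath :=
      (Q.concat hq.1).isPath_of_length_eq_dist (by rw [Walk.length_concat, hQ, hq.2])
    have := congrArg Walk.penultimate ((hT.existsUnique_path r c).unique hPc hQc)
    simpa using this
  · intro v hv
    obtain ⟨P, hP⟩ := hT.connected.exists_walk_length_eq_dist r v
    have hnil : ¬ P.Nil := Walk.not_nil_of_ne hv.symm
    have hadj := P.adj_penultimate hnil
    refine ⟨P.penultimate, by
      simp only [mem_filter, mem_univ, true_and]
      refine ⟨hadj, ?_⟩
      have h1 := dist_le P.dropLast
      have h2 := hT.dist_eq_dist_add_one_of_adj r hadj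
      have h3 : P.dropLast.length = P.length - 1 := by simp
      omega⟩
  · intro u v
    simp only [mem_filter, mem_univ, true_and]
    constructor
    · intro h
      have := hT.dist_eq_dist_add_one_of_adj r h
      have h' := h.symm
      tauto
    · rintro (h | h)
      exacts [h.1, h.1.symm]

lemma SimpleGraph.IsTree.exists_degree_le_one [Fintype V] {T : SimpleGraph V}
    [DecidableRel T.Adj] (hT : T.IsTree) : ∃ r, T.degree r ≤ 1 := by
  rcases subsingleton_or_nontrivial V with h | h
  · obtain ⟨r⟩ := hT.connected.nonempty
    have h1 := T.degree_lt_card_verts r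
    have h2 := Fintype.card_le_one_iff_subsingleton.2 h
    exact ⟨r, by omega⟩
  · obtain ⟨r, hr⟩ := hT.exists_vert_degree_one_of_nontrivial
    exact ⟨r, hr.le⟩

/-- There is an unsolvable distribution of `γ_ω(T) - 1` pebbles all of whose pebbles
lie on leaves of the tree `T`. -/
theorem exists_unsolvable_distribution_on_leaves (T : SimpleGraph V) [Fintype V]
    [DecidableRel T.Adj] (hT : T.IsTree) (ω : V → ℕ) (hγ : 1 ≤ coverNum T ω) :
    ∃ D : V → ℕ, ¬ Solvable T ω D ∧ (∑ x, D x) = coverNum T ω - 1 ∧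
      ∀ v, 2 ≤ T.degree v → D v = 0 := by
  obtain ⟨r, hr⟩ := hT.exists_degree_le_one
  obtain ⟨R, rfl, hR⟩ := hT.exists_rooting r
  have hN := Nat.notMem_of_lt_sInf (Nat.sub_one_lt_of_le hγ le_rfl)
  simp only [Set.mem_ofPred_eq, not_forall] at hN
  obtain ⟨D, hD, hunsolv⟩ := hN
  obtain ⟨D', hclear, hsum, hexc⟩ := R.exists_clearOn ω D univ fun _ _ => subset_univ _
  refine ⟨D', ?_, hsum.trans hD, fun v hv => ?_⟩
  · rw [R.solvable_iff hR] at hunsolv ⊢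
    omega
  · refine hclear v (mem_univ v) (by rintro rfl; omega) ?_
    obtain ⟨a, ha, b, hb, hab⟩ := one_lt_card.1 (by rwa [card_neighborFinset_eq_degree] :
      1 < (T.neighborFinset v).card)
    rw [mem_neighborFinset] at ha hb
    rcases (hR v a).1 ha with ha | ha
    · exact ⟨a, ha⟩
    rcases (hR v b).1 hb with hb | hb
    · exact ⟨b, hb⟩
    exact absurd (R.parent_unique ha hb) hab
end

section
/- Let T be a tree, v a vertex of T, and suppose (a_1, a_2, ..., a_n) (in nonincreasing order) is the sequence of path lengths of the maximum path partition of the tree T rooted at v (all edges directed toward v). Then the t-pebbling number of v in T is f_t(T, v) = t·2^{a_1} + Σ_{i=2}^{n} 2^{a_i} − n + 1. -/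
open SimpleGraph Finset

variable {V : Type*} [DecidableEq V]

/-- A system of (directed) paths in `G`, each recorded as a walk with its endpoints. -/
abbrev PathSys (G : SimpleGraph V) := List (Σ a : V, Σ b : V, G.Walk a b)

/-- The list of lengths of the paths in the system. -/
def sysLengths {G : SimpleGraph V} (P : PathSys G) : List ℕ := P.map fun q => q.2.2.length

/-- `P` is a path partition of the directed graph whose edges are the edges of `G`
oriented so that the potential `φ` strictly decreases (for trees, `φ` is the distance
to the root or to the target subtree): the paths are directed (each dart decreases `φ`),
nontrivial, pairwise edge-disjoint, and together cover every directable edge. -/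
def IsPartitionTo (G : SimpleGraph V) (φ : V → ℕ) (P : PathSys G) : Prop :=
  (∀ q ∈ P, q.2.2.IsPath ∧ 0 < q.2.2.length ∧ ∀ d ∈ q.2.2.darts, φ d.snd < φ d.fst) ∧
  P.Pairwise (fun q r => ∀ e ∈ q.2.2.edges, e ∉ r.2.2.edges) ∧
  ∀ a b : V, G.Adj a b → φ b < φ a → ∃ q ∈ P, s(a, b) ∈ q.2.2.edges

/-- Sort a list of naturals in nonincreasing order. -/
def sortDesc (l : List ℕ) : List ℕ := l.insertionSort (· ≥ ·)

/-- `P` is a maximum path partition: its nonincreasing length sequence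
lexicographically majorizes that of every other path partition. -/
def IsMaxPartitionTo (G : SimpleGraph V) (φ : V → ℕ) (P : PathSys G) : Prop :=
  IsPartitionTo G φ P ∧ ∀ Q : PathSys G, IsPartitionTo G φ Q →
    ¬ List.Lex (· < ·) (sortDesc (sysLengths P)) (sortDesc (sysLengths Q))

/-- `∑ᵢ (2^{aᵢ} - 1)` over the path lengths of the system. -/
def pathsExtra {G : SimpleGraph V} (P : PathSys G) : ℕ :=
  ((sysLengths P).map fun a => 2 ^ a - 1).sum

/-- Vertices of the minimal subtree spanning `S`: vertices lying on a geodesic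
between two members of `S`. -/
def subtreeSpan (G : SimpleGraph V) (S : Set V) : Set V :=
  {u | ∃ x ∈ S, ∃ y ∈ S, G.dist x u + G.dist u y = G.dist x y}

/-- Distance from a vertex to a set. -/
noncomputable def distToSet (G : SimpleGraph V) (A : Set V) (u : V) : ℕ :=
  sInf {n | ∃ w ∈ A, G.dist u w = n}

/-- The potential used for `s_ω(v)`: the distance to the minimal subtree `T_ω(v)`
containing `v` and the support of `ω`. -/
noncomputable def phiOmega (G : SimpleGraph V) (ω : V → ℕ) (v : V) : V → ℕ :=
  distToSet G (subtreeSpan G (insert v {u | 0 < ω u}))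

set_option linter.unusedSectionVars false

/-- `par` sends every vertex of the graph rooted at `v` to its unique neighbour closer to `v`,
and fixes `v`. -/
structure IsParentMap (G : SimpleGraph V) (v : V) (par : V → V) : Prop where
  root : par v = v
  adj : ∀ {x}, x ≠ v → G.Adj x (par x)
  dist_add_one : ∀ {x}, x ≠ v → G.dist (par x) v + 1 = G.dist x v
  eq_of_adj : ∀ {x y}, G.Adj x y → G.dist y v < G.dist x v → y = par x
  dist_ne : ∀ {x y}, G.Adj x y → G.dist x v ≠ G.dist y v

theorem SimpleGraph.IsTree.exists_isParentMap {T : SimpleGraph V} (hT : T.IsTree) (v : V) :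
    ∃ par, IsParentMap T v par := by
  have hex : ∀ x, ∃ y, x ≠ v → T.Adj x y ∧ T.dist y v + 1 = T.dist x v := by
    intro x
    by_cases hx : x = v
    · exact ⟨x, fun h => absurd hx h⟩
    obtain ⟨w, hw⟩ := hT.connected.exists_walk_length_eq_dist x v
    cases w with
    | nil => exact absurd rfl hx
    | @cons _ y _ h p =>
      refine ⟨y, fun _ => ⟨h, ?_⟩⟩
      have h1 := dist_le p
      rw [Walk.length_cons] at hw
      have h2 := hT.dist_eq_dist_add_one_of_adj v h
      rw [dist_comm (u := v), dist_comm (u := v)] at h2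
      omega
  choose f hf using hex
  have hlt : ∀ {x y}, T.Adj x y → T.dist y v < T.dist x v → T.dist y v + 1 = T.dist x v := by
    intro x y h hd
    have h2 := hT.dist_eq_dist_add_one_of_adj v h
    rw [dist_comm (u := v), dist_comm (u := v)] at h2
    omega
  have huniq : ∀ {x y z}, T.Adj x y → T.dist y v + 1 = T.dist x v →
      T.Adj x z → T.dist z v + 1 = T.dist x v → y = z := by
    intro x y z hy hdy hz hdz
    obtain ⟨p, hp⟩ := hT.connected.exists_walk_length_eq_dist y v
    obtain ⟨q, hq⟩ := hT.connected.exists_walk_length_eq_dist z v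
    have hP : (Walk.cons hy p).IsPath :=
      Walk.isPath_of_length_eq_dist _ (by rw [Walk.length_cons, hp, hdy])
    have hQ : (Walk.cons hz q).IsPath :=
      Walk.isPath_of_length_eq_dist _ (by rw [Walk.length_cons, hq, hdz])
    have := (hT.existsUnique_path x v).unique hP hQ
    have h2 := congrArg Walk.snd this
    simpa using h2
  refine ⟨fun x => if x = v then v else f x, by simp, ?_, ?_, ?_, ?_⟩
  · intro x hx
    simpa [hx] using (hf x hx).1
  · intro x hx
    simpa [hx] using (hf x hx).2
  · intro x y h hd
    have hx : x ≠ v := by rintro rfl; simp at hd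
    simpa [hx] using huniq h (hlt h hd) (hf x hx).1 (hf x hx).2
  · intro x y h
    rw [dist_comm (u := x), dist_comm (u := y)]
    exact hT.dist_ne_of_adj v h

namespace IsParentMap

variable {G : SimpleGraph V} {v : V} {par : V → V}

theorem dist_pos (hp : IsParentMap G v par) {x : V} (hx : x ≠ v) : 0 < G.dist x v := by
  have := hp.dist_add_one hx
  omega

theorem dist_par (hp : IsParentMap G v par) (x : V) : G.dist (par x) v = G.dist x v - 1 := by
  by_cases hx : x = v
  · subst hx
    simp [hp.root]
  · have := hp.dist_add_one hx
    omega

theorem dist_iterate (hp : IsParentMap G v par) (x : V) (n : ℕ) :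
    G.dist (par^[n] x) v = G.dist x v - n := by
  induction n with
  | zero => simp
  | succ n ih => rw [Function.iterate_succ_apply', hp.dist_par, ih]; omega

theorem dist_lt (hp : IsParentMap G v par) {x : V} (hx : x ≠ v) :
    G.dist (par x) v < G.dist x v := by
  have := hp.dist_add_one hx
  omega

theorem ne_root_of_dist_lt {x y : V} (h : G.dist y v < G.dist x v) : x ≠ v := by
  rintro rfl
  simp at h

/-- Every edge joins a non-root vertex to its parent. -/
theorem adj_cases (hp : IsParentMap G v par) {x y : V} (h : G.Adj x y) :
    (x ≠ v ∧ y = par x) ∨ (y ≠ v ∧ x = par y) := by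
  rcases lt_or_gt_of_ne (hp.dist_ne h) with hd | hd
  · exact Or.inr ⟨ne_root_of_dist_lt hd, hp.eq_of_adj h.symm hd⟩
  · exact Or.inl ⟨ne_root_of_dist_lt hd, hp.eq_of_adj h hd⟩

theorem edge_injective (hp : IsParentMap G v par) {x y : V} (hx : x ≠ v) (hy : y ≠ v)
    (h : s(x, par x) = s(y, par y)) : x = y := by
  rcases Sym2.eq_iff.1 h with h | ⟨h1, h2⟩
  · exact h.1
  · have e1 := hp.dist_add_one hx
    have e2 := hp.dist_add_one hy
    rw [h2] at e1
    rw [← h1] at e2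
    omega

/-- A directed walk is determined by its source and its length. -/
theorem edges_eq_of_directed (hp : IsParentMap G v par) {a b : V} (w : G.Walk a b)
    (hw : ∀ d ∈ w.darts, G.dist d.snd v < G.dist d.fst v) :
    w.edges = (List.iterate par a w.length).map (fun x => s(x, par x)) ∧
      ∀ x ∈ List.iterate par a w.length, x ≠ v := by
  induction w with
  | nil => simp [List.iterate]
  | @cons a c b h p ih =>
    simp only [Walk.darts_cons, List.mem_cons, forall_eq_or_imp] at hw
    obtain rfl := hp.eq_of_adj h hw.1
    obtain ⟨h1, h2⟩ := ih hw.2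
    refine ⟨by simp [List.iterate, h1], ?_⟩
    simp only [Walk.length_cons, List.iterate, List.mem_cons, forall_eq_or_imp]
    exact ⟨ne_root_of_dist_lt hw.1, h2⟩

theorem exists_directed_walk (hp : IsParentMap G v par) (n : ℕ) (s : V)
    (h : ∀ x ∈ List.iterate par s n, x ≠ v) :
    ∃ (b : V) (w : G.Walk s b), w.length = n ∧
      ∀ d ∈ w.darts, G.dist d.snd v < G.dist d.fst v := by
  induction n generalizing s with
  | zero => exact ⟨s, .nil, rfl, by simp⟩
  | succ n ih =>
    simp only [List.iterate, List.mem_cons, forall_eq_or_imp] at h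
    obtain ⟨b, w, hw, hd⟩ := ih (par s) h.2
    refine ⟨b, .cons (hp.adj h.1) w, by simp [hw], ?_⟩
    simp only [Walk.darts_cons, List.mem_cons, forall_eq_or_imp]
    exact ⟨hp.dist_lt h.1, hd⟩

end IsParentMap

/-- A path partition of the directed tree, each path encoded by its source and length: every
non-root vertex is the tail of exactly one edge, so the tails of the paths must enumerate the
non-root vertices. -/
structure IsTailPartition (v : V) (par : V → V) (L : List (V × ℕ)) : Prop where
  pos : ∀ q ∈ L, 0 < q.2
  nodup : (L.flatMap fun q => List.iterate par q.1 q.2).Nodup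
  mem_iff : ∀ x, x ∈ (L.flatMap fun q => List.iterate par q.1 q.2) ↔ x ≠ v

theorem IsPartitionTo.exists_isTailPartition {G : SimpleGraph V} {v : V} {par : V → V}
    (hp : IsParentMap G v par) {P : PathSys G} (hP : IsPartitionTo G (fun u => G.dist u v) P) :
    ∃ L, IsTailPartition v par L ∧ sysLengths P = L.map Prod.snd := by
  obtain ⟨h1, h2, h3⟩ := hP
  have he := fun q hq => hp.edges_eq_of_directed q.2.2 (h1 q hq).2.2
  refine ⟨P.map fun q => (q.1, q.2.2.length), ⟨?_, ?_, fun x => ⟨?_, fun hx => ?_⟩⟩,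
    by simp [sysLengths]⟩
  · simp only [List.mem_map, forall_exists_index, and_imp]
    rintro _ q hq rfl
    exact (h1 q hq).2.1
  · rw [List.flatMap_map, List.nodup_flatMap]
    refine ⟨fun q hq => ?_, h2.imp_of_mem fun {q r} hq hr hd => ?_⟩
    · have := (h1 q hq).1.isTrail.edges_nodup
      rw [(he q hq).1] at this
      exact this.of_map
    · intro x hxq hxr
      refine hd s(x, par x) ?_ ?_
      · rw [(he q hq).1]; exact List.mem_map_of_mem hxq
      · rw [(he r hr).1]; exact List.mem_map_of_mem hxr
  · rw [List.flatMap_map, List.mem_flatMap]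
    rintro ⟨q, hq, hx⟩
    exact (he q hq).2 x hx
  · obtain ⟨q, hq, hx'⟩ := h3 x (par x) (hp.adj hx) (hp.dist_lt hx)
    rw [(he q hq).1, List.mem_map] at hx'
    obtain ⟨y, hy, hyx⟩ := hx'
    obtain rfl := hp.edge_injective ((he q hq).2 y hy) hx hyx
    rw [List.flatMap_map, List.mem_flatMap]
    exact ⟨q, hq, hy⟩

theorem IsTailPartition.exists_isPartitionTo {T : SimpleGraph V} (hT : T.IsTree) {v : V}
    {par : V → V} (hp : IsParentMap T v par) {L : List (V × ℕ)} (hL : IsTailPartition v par L) :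
    ∃ Q : PathSys T, IsPartitionTo T (fun u => T.dist u v) Q ∧ sysLengths Q = L.map Prod.snd := by
  have hne : ∀ q ∈ L, ∀ x ∈ List.iterate par q.1 q.2, x ≠ v := fun q hq x hx =>
    (hL.mem_iff x).1 (List.mem_flatMap.2 ⟨q, hq, hx⟩)
  have hwalk : ∀ q : V × ℕ, ∃ w : Σ a : V, Σ b : V, T.Walk a b, q ∈ L →
      w.1 = q.1 ∧ w.2.2.length = q.2 ∧
        ∀ d ∈ w.2.2.darts, T.dist d.snd v < T.dist d.fst v := by
    intro q
    by_cases hq : q ∈ L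
    · obtain ⟨b, w, h⟩ := hp.exists_directed_walk q.2 q.1 (hne q hq)
      exact ⟨⟨q.1, b, w⟩, fun _ => ⟨rfl, h⟩⟩
    · exact ⟨⟨v, v, .nil⟩, fun h => absurd h hq⟩
  choose f hf using hwalk
  have he : ∀ q ∈ L, (f q).2.2.edges =
      (List.iterate par q.1 q.2).map (fun x => s(x, par x)) := by
    intro q hq
    rw [(hp.edges_eq_of_directed _ (hf q hq).2.2).1, (hf q hq).2.1, (hf q hq).1]
  have hnd := List.nodup_flatMap.1 hL.nodup
  refine ⟨L.map f, ⟨?_, ?_, ?_⟩, ?_⟩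
  · simp only [List.mem_map, forall_exists_index, and_imp]
    rintro _ q hq rfl
    refine ⟨(hT.isAcyclic.isPath_iff_isTrail _).2 ⟨?_⟩, ?_, (hf q hq).2.2⟩
    · rw [he q hq]
      exact (hnd.1 q hq).map_on fun x hx y hy => hp.edge_injective (hne q hq x hx) (hne q hq y hy)
    · rw [(hf q hq).2.1]
      exact hL.pos q hq
  · refine List.pairwise_map.2 (hnd.2.imp_of_mem fun {q r} hq hr hd => ?_)
    rw [he q hq, he r hr]
    simp only [List.mem_map, not_exists, not_and, forall_exists_index, and_imp]
    rintro _ x hx rfl y hy hyx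
    obtain rfl := hp.edge_injective (hne r hr y hy) (hne q hq x hx) hyx
    exact hd hx hy
  · intro a b hab hd
    obtain rfl := hp.eq_of_adj hab hd
    obtain ⟨q, hq, hx⟩ := List.mem_flatMap.1 ((hL.mem_iff a).2
      (IsParentMap.ne_root_of_dist_lt hd))
    refine ⟨f q, List.mem_map_of_mem hq, ?_⟩
    rw [he q hq]
    exact List.mem_map_of_mem hx
  · rw [sysLengths, List.map_map]
    exact List.map_congr_left fun q hq => (hf q hq).2.1

theorem List.lex_of_count_lt {m : ℕ} {l₁ l₂ : List ℕ} (h₁ : l₁.Pairwise (· ≥ ·))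
    (h₂ : l₂.Pairwise (· ≥ ·)) (heq : ∀ k > m, l₁.count k = l₂.count k)
    (hlt : l₁.count m < l₂.count m) : List.Lex (· < ·) l₁ l₂ := by
  induction l₂ generalizing l₁ with
  | nil => simp at hlt
  | cons b t₂ ih =>
    cases l₁ with
    | nil => exact .nil
    | cons a t₁ =>
      rw [List.pairwise_cons] at h₁ h₂
      rcases lt_trichotomy a b with hab | rfl | hab
      · exact .rel hab
      · refine .cons (ih h₁.2 h₂.2 (fun k hk => ?_) ?_)
        · simpa [List.count_cons] using heq k hk
        · simpa [List.count_cons] using hlt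
      · have hz : ∀ k, b < k → (b :: t₂).count k = 0 := fun k hk =>
          List.count_eq_zero.2 fun hmem => by
            rcases List.mem_cons.1 hmem with rfl | h
            · exact lt_irrefl _ hk
            · exact absurd (h₂.1 k h) (by omega)
        have hma : m < a := by
          by_contra hle
          rw [hz m (by omega)] at hlt
          omega
        have := heq a hma
        rw [hz a hab] at this
        simp at this

theorem not_isMaxPartitionTo_of_count_lt {G : SimpleGraph V} {φ : V → ℕ} {P Q : PathSys G}
    (hQ : IsPartitionTo G φ Q) (m : ℕ)
    (heq : ∀ k > m, (sysLengths P).count k = (sysLengths Q).count k)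
    (hlt : (sysLengths P).count m < (sysLengths Q).count m) : ¬ IsMaxPartitionTo G φ P := by
  intro hP
  refine hP.2 Q hQ (List.lex_of_count_lt (m := m) (List.pairwise_insertionSort _ _)
    (List.pairwise_insertionSort _ _) (fun k hk => ?_) ?_)
  · rw [sortDesc, sortDesc, (List.perm_insertionSort _ _).count_eq,
      (List.perm_insertionSort _ _).count_eq, heq k hk]
  · rwa [sortDesc, sortDesc, (List.perm_insertionSort _ _).count_eq,
      (List.perm_insertionSort _ _).count_eq]

/-- The height of `x` in the tree rooted at `v`: the greatest distance from `x` to a descendant. -/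
noncomputable def treeHeight [Fintype V] (G : SimpleGraph V) (v : V) (par : V → V) (x : V) : ℕ :=
  (univ.filter fun y => par^[G.dist y v - G.dist x v] y = x).sup fun y => G.dist y v - G.dist x v

namespace IsParentMap

variable {G : SimpleGraph V} {v : V} {par : V → V} [Fintype V]

theorem le_treeHeight (hp : IsParentMap G v par) {x y : V} {n : ℕ} (hxy : par^[n] y = x)
    (hn : n ≤ G.dist y v) : n ≤ treeHeight G v par x := by
  have hd : G.dist y v - G.dist x v = n := by
    rw [← hxy, hp.dist_iterate]
    omega
  have := Finset.le_sup (s := univ.filter fun y => par^[G.dist y v - G.dist x v] y = x)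
    (f := fun y => G.dist y v - G.dist x v) (b := y) (by simp [hd, hxy])
  rwa [hd] at this

theorem exists_iterate_treeHeight (G : SimpleGraph V) (v : V) (par : V → V) (x : V) :
    ∃ y, par^[treeHeight G v par x] y = x ∧ G.dist y v = G.dist x v + treeHeight G v par x := by
  obtain ⟨y, hy, he⟩ := Finset.exists_mem_eq_sup
    (univ.filter fun y => par^[G.dist y v - G.dist x v] y = x) ⟨x, by simp⟩
    (fun y => G.dist y v - G.dist x v)
  have hy' := (Finset.mem_filter.1 hy).2
  change treeHeight G v par x = _ at he
  rw [he]
  refine ⟨y, hy', ?_⟩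
  by_cases hlt : G.dist y v < G.dist x v
  · rw [Nat.sub_eq_zero_of_le hlt.le] at hy'
    obtain rfl : y = x := hy'
    simp
  · omega

theorem treeHeight_add_one_le (hp : IsParentMap G v par) {x : V} (hx : x ≠ v) :
    treeHeight G v par x + 1 ≤ treeHeight G v par (par x) := by
  obtain ⟨y, hy, hd⟩ := exists_iterate_treeHeight G v par x
  have := hp.dist_pos hx
  exact hp.le_treeHeight (by rw [Function.iterate_succ_apply', hy]) (by omega)

theorem treeHeight_lt_root (hp : IsParentMap G v par) {x : V} (hx : x ≠ v) :
    treeHeight G v par x < treeHeight G v par v := by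
  obtain ⟨y, -, hd⟩ := exists_iterate_treeHeight G v par x
  have hx := hp.dist_pos hx
  have hroot : par^[G.dist y v] y = v := by
    by_contra h
    have := hp.dist_pos h
    rw [hp.dist_iterate] at this
    omega
  have := hp.le_treeHeight hroot le_rfl
  omega

theorem exists_child_of_treeHeight_pos (hp : IsParentMap G v par) {x : V}
    (hx : 0 < treeHeight G v par x) :
    ∃ c, c ≠ v ∧ par c = x ∧ treeHeight G v par c + 1 = treeHeight G v par x := by
  obtain ⟨y, hy, hd⟩ := exists_iterate_treeHeight G v par x
  obtain ⟨k, hk⟩ := Nat.exists_eq_succ_of_ne_zero hx.ne'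
  rw [hk] at hy hd
  rw [Function.iterate_succ_apply'] at hy
  have hc : par^[k] y ≠ v := by
    intro h
    have := hp.dist_iterate y k
    rw [h, dist_self] at this
    omega
  refine ⟨_, hc, hy, ?_⟩
  have h1 := hp.le_treeHeight (x := par^[k] y) rfl (by omega)
  have h2 := hp.treeHeight_add_one_le hc
  rw [hy] at h2
  omega

end IsParentMap

theorem IsTailPartition.iterate_ne {v : V} {par : V → V} {L : List (V × ℕ)}
    (hL : IsTailPartition v par L) {q : V × ℕ} (hq : q ∈ L) {j : ℕ} (hj : j < q.2) :
    par^[j] q.1 ≠ v :=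
  (hL.mem_iff _).1 (List.mem_flatMap.2 ⟨q, hq, List.mem_iterate.2 ⟨j, hj, rfl⟩⟩)

theorem IsTailPartition.exists_iterate_eq {v : V} {par : V → V} {L : List (V × ℕ)}
    (hL : IsTailPartition v par L) {x : V} (hx : x ≠ v) :
    ∃ q ∈ L, ∃ j < q.2, par^[j] q.1 = x := by
  obtain ⟨q, hq, hxq⟩ := List.mem_flatMap.1 ((hL.mem_iff x).2 hx)
  obtain ⟨j, hj, he⟩ := List.mem_iterate.1 hxq
  exact ⟨q, hq, j, hj, he.symm⟩

/-- Cutting a path at a vertex where a longer path ends, and prolonging the latter with the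
part cut off. -/
theorem IsTailPartition.exchange {v : V} {par : V → V} {s s' : V} {ℓ ℓ' j : ℕ}
    {R : List (V × ℕ)} (hL : IsTailPartition v par ((s', ℓ') :: (s, ℓ) :: R)) (hj : j < ℓ)
    (h : par^[j] s = par^[ℓ'] s') :
    IsTailPartition v par
      ((s', ℓ' + (ℓ - j)) :: ((if j = 0 then [] else [(s, j)]) ++ R)) := by
  have hperm : (((s', ℓ' + (ℓ - j)) :: ((if j = 0 then [] else [(s, j)]) ++ R)).flatMap
      fun q => List.iterate par q.1 q.2).Perm
      (((s', ℓ') :: (s, ℓ) :: R).flatMap fun q => List.iterate par q.1 q.2) := by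
    have e1 : List.iterate par s ℓ =
        List.iterate par s j ++ List.iterate par (par^[j] s) (ℓ - j) := by
      rw [← List.iterate_add]
      congr 1
      omega
    have e2 : ((if j = 0 then [] else [(s, j)]).flatMap fun q => List.iterate par q.1 q.2) =
        List.iterate par s j := by
      split_ifs with h0
      · simp [h0, List.iterate]
      · simp
    rw [List.flatMap_cons, List.flatMap_append, e2, List.flatMap_cons, List.flatMap_cons, e1,
      List.iterate_add, h, List.append_assoc, List.append_assoc]
    refine List.Perm.append_left _ ?_
    rw [← List.append_assoc, ← List.append_assoc]
    exact List.perm_append_comm.append_right _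
  refine ⟨?_, hperm.nodup_iff.2 hL.nodup, fun x => hperm.mem_iff.trans (hL.mem_iff x)⟩
  intro q hq
  rcases List.mem_cons.1 hq with rfl | hq
  · simp only
    omega
  rcases List.mem_append.1 hq with hq | hq
  · split_ifs at hq with h0
    · simp at hq
    · obtain rfl := List.mem_singleton.1 hq
      exact Nat.pos_of_ne_zero h0
  · exact hL.pos q (by simp [hq])

/-- In a maximum path partition, the part of a path before a vertex `x` is as long as possible. -/
theorem IsMaxPartitionTo.eq_treeHeight [Fintype V] {T : SimpleGraph V} (hT : T.IsTree) {v : V}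
    {par : V → V} (hp : IsParentMap T v par) {P : PathSys T}
    (hP : IsMaxPartitionTo T (fun u => T.dist u v) P) {L : List (V × ℕ)}
    (hL : IsTailPartition v par L) (hPL : sysLengths P = L.map Prod.snd) {q : V × ℕ}
    (hq : q ∈ L) {j : ℕ} (hj : j < q.2) : treeHeight T v par (par^[j] q.1) = j := by
  induction hn : treeHeight T v par (par^[j] q.1) using Nat.strong_induction_on
    generalizing q j with
  | _ n ih =>
  set x := par^[j] q.1 with hx
  have hxv : x ≠ v := hL.iterate_ne hq hj
  have hdx := hp.dist_iterate q.1 j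
  have hdpos := hp.dist_pos hxv
  rw [← hx] at hdx
  have hjn : j ≤ n := hn ▸ hp.le_treeHeight hx.symm (by omega)
  by_contra hne
  obtain ⟨c, hcv, hcx, hc⟩ := hp.exists_child_of_treeHeight_pos (x := x) (by omega)
  obtain ⟨q', hq', j', hj', hcq⟩ := hL.exists_iterate_eq hcv
  have hj'c := ih (treeHeight T v par c) (by omega) hq' hj' (by rw [hcq])
  have hx' : par^[j' + 1] q'.1 = x := by rw [Function.iterate_succ_apply', hcq, hcx]
  have hdx' := hp.dist_iterate q'.1 (j' + 1)
  rw [hx'] at hdx'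
  have hqq : q' ≠ q := by
    rintro rfl
    omega
  have hℓ' : q'.2 = j' + 1 := by
    by_contra h
    have hd := (List.nodup_flatMap.1 hL.nodup).2
    have : Std.Symm (Function.onFun List.Disjoint fun q : V × ℕ => List.iterate par q.1 q.2) :=
      ⟨fun _ _ h => List.Disjoint.symm h⟩
    exact hd.forall hq' hq hqq
      (List.mem_iterate.2 ⟨j' + 1, by omega, hx'.symm⟩) (List.mem_iterate.2 ⟨j, hj, hx⟩)
  have hperm : L.Perm (q' :: q :: (L.erase q').erase q) :=
    (List.perm_cons_erase hq').trans
      ((List.perm_cons_erase ((List.mem_erase_of_ne hqq.symm).2 hq)).cons _)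
  generalize (L.erase q').erase q = R at hperm
  obtain ⟨s', ℓ'⟩ := q'
  obtain ⟨s, ℓ⟩ := q
  dsimp only at *
  have hflat := hperm.flatMap_right fun q => List.iterate par q.1 q.2
  have hL' : IsTailPartition v par ((s', ℓ') :: (s, ℓ) :: R) :=
    ⟨fun q h => hL.pos q (hperm.mem_iff.2 h), hflat.nodup_iff.1 hL.nodup,
      fun y => hflat.mem_iff.symm.trans (hL.mem_iff y)⟩
  have hM := hL'.exchange hj (by rw [← hx, hℓ', hx'])
  obtain ⟨Q, hQ, hQl⟩ := hM.exists_isPartitionTo hT hp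
  refine not_isMaxPartitionTo_of_count_lt hQ (ℓ' + (ℓ - j)) (fun k hk => ?_) ?_ hP
  · rw [hPL, hQl, (hperm.map _).count_eq]
    have h1 : ℓ' ≠ k := by omega
    have h2 : ℓ ≠ k := by omega
    have h3 : ℓ' + (ℓ - j) ≠ k := by omega
    have h4 : j ≠ k := by omega
    split_ifs <;> simp [h1, h2, h3, h4]
  · rw [hPL, hQl, (hperm.map _).count_eq]
    have h1 : ℓ - j ≠ 0 := by omega
    have h2 : ℓ ≠ ℓ' + (ℓ - j) := by omega
    have h4 : j ≠ ℓ' + (ℓ - j) := by omega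
    split_ifs <;> simp [h1, h2, h4]

theorem IsTailPartition.sum_eq [Fintype V] {v : V} {par : V → V} {L : List (V × ℕ)}
    (hL : IsTailPartition v par L) (f : V → ℕ) :
    ∑ x ∈ univ.erase v, f x =
      (L.map fun q => ((List.iterate par q.1 q.2).map f).sum).sum := by
  have hfin : (L.flatMap fun q => List.iterate par q.1 q.2).toFinset = univ.erase v := by
    ext x
    rw [List.mem_toFinset, hL.mem_iff]
    simp
  rw [← hfin, List.sum_toFinset f hL.nodup, List.map_flatMap, List.flatMap, List.sum_flatten,
    List.map_map]
  rfl

theorem List.sum_map_two_pow_range (n : ℕ) :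
    ((List.range n).map fun j => 2 ^ j).sum = 2 ^ n - 1 := by
  have := Nat.geomSum_eq (m := 2) le_rfl n
  rw [Nat.div_one] at this
  exact this

theorem IsMaxPartitionTo.sum_two_pow_treeHeight [Fintype V] {T : SimpleGraph V} (hT : T.IsTree)
    {v : V} {par : V → V} (hp : IsParentMap T v par) {P : PathSys T}
    (hP : IsMaxPartitionTo T (fun u => T.dist u v) P) :
    ∑ x ∈ univ.erase v, 2 ^ treeHeight T v par x =
      ((sysLengths P).map fun a => 2 ^ a - 1).sum := by
  obtain ⟨L, hL, hPL⟩ := hP.1.exists_isTailPartition hp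
  rw [hL.sum_eq, hPL, List.map_map]
  congr 1
  refine List.map_congr_left fun q hq => ?_
  rw [← List.range_map_iterate, List.map_map, Function.comp_apply, ← List.sum_map_two_pow_range]
  congr 1
  refine List.map_congr_left fun j hj => ?_
  rw [Function.comp_apply, hP.eq_treeHeight hT hp hL hPL hq (List.mem_range.1 hj)]

theorem IsMaxPartitionTo.head_eq_treeHeight [Fintype V] {T : SimpleGraph V} (hT : T.IsTree)
    {v : V} {par : V → V} (hp : IsParentMap T v par) {P : PathSys T}
    (hP : IsMaxPartitionTo T (fun u => T.dist u v) P) {a : ℕ} {rest : List ℕ}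
    (ha : sortDesc (sysLengths P) = a :: rest) : treeHeight T v par v = a := by
  obtain ⟨L, hL, hPL⟩ := hP.1.exists_isTailPartition hp
  have hperm : (L.map Prod.snd).Perm (a :: rest) := by
    rw [← ha, ← hPL]
    exact (List.perm_insertionSort _ _).symm
  have hmax : ∀ b ∈ rest, b ≤ a := by
    have : (sortDesc (sysLengths P)).Pairwise (· ≥ ·) := List.pairwise_insertionSort _ _
    rw [ha] at this
    exact (List.pairwise_cons.1 this).1
  have hle : ∀ q ∈ L, q.2 ≤ treeHeight T v par v := by
    intro q hq
    have hpos := hL.pos q hq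
    have h1 := hP.eq_treeHeight hT hp hL hPL hq (j := q.2 - 1) (by omega)
    have h2 := hp.treeHeight_lt_root (hL.iterate_ne hq (j := q.2 - 1) (by omega))
    omega
  obtain ⟨q, hq, rfl⟩ := List.mem_map.1 (hperm.mem_iff.2 List.mem_cons_self)
  refine le_antisymm ?_ (hle q hq)
  obtain ⟨c, hcv, hc, hch⟩ := hp.exists_child_of_treeHeight_pos
    (x := v) ((hL.pos q hq).trans_le (hle q hq))
  obtain ⟨r, hr, j, hj, hjc⟩ := hL.exists_iterate_eq hcv
  have h1 := hP.eq_treeHeight hT hp hL hPL hr hj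
  have h2 : r.2 ≤ q.2 := by
    rcases List.mem_cons.1 (hperm.mem_iff.1 (List.mem_map_of_mem hr)) with h | h
    · exact h.le
    · exact hmax _ h
  rw [hjc] at h1
  omega

theorem PebStep.of_adj {G : SimpleGraph V} {D : V → ℕ} {u w : V} (h : G.Adj u w) (hu : 2 ≤ D u) :
    ∃ D', PebStep G D D' ∧
      ∀ x, D' x + (if x = u then 2 else 0) = D x + (if x = w then 1 else 0) := by
  refine ⟨_, ⟨u, w, h, hu, rfl⟩, fun x => ?_⟩
  have := h.ne
  by_cases hxu : x = u
  · subst hxu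
    simp [this, hu]
  · by_cases hxw : x = w <;> simp [hxu, hxw, h.ne.symm]

theorem PebStep.exists_adj {G : SimpleGraph V} {D D' : V → ℕ} (h : PebStep G D D') :
    ∃ u w, G.Adj u w ∧ 2 ≤ D u ∧
      ∀ x, D' x + (if x = u then 2 else 0) = D x + (if x = w then 1 else 0) := by
  obtain ⟨u, w, huw, hu, rfl⟩ := h
  refine ⟨u, w, huw, hu, fun x => ?_⟩
  have := huw.ne
  by_cases hxu : x = u
  · subst hxu
    simp [this, hu]
  · by_cases hxw : x = w <;> simp [hxu, hxw, huw.ne.symm]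

/-- A distribution whose weight, with respect to the heights in the tree, is large enough allows
to move `k + 1` pebbles onto the root. -/
theorem IsParentMap.exists_pebReach [Fintype V] {G : SimpleGraph V} {v : V} {par : V → V}
    (hp : IsParentMap G v par) (k : ℕ) (D : V → ℕ)
    (hD : k * 2 ^ treeHeight G v par v + ∑ x ∈ univ.erase v, 2 ^ treeHeight G v par x <
      ∑ x, D x * 2 ^ treeHeight G v par x) :
    ∃ D', PebReach G D D' ∧ k + 1 ≤ D' v := by
  induction hn : ∑ x, D x using Nat.strong_induction_on generalizing D with
  | _ n ih =>
  by_cases hall : ∀ x ≠ v, D x ≤ 1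
  · refine ⟨D, .refl, ?_⟩
    by_contra hk
    rw [← Finset.add_sum_erase _ _ (mem_univ v)] at hD
    have h1 : ∑ x ∈ univ.erase v, D x * 2 ^ treeHeight G v par x ≤
        ∑ x ∈ univ.erase v, 2 ^ treeHeight G v par x :=
      Finset.sum_le_sum fun x hx => by
        simpa using Nat.mul_le_mul_right (2 ^ treeHeight G v par x)
          (hall x (Finset.ne_of_mem_erase hx))
    have h2 : D v * 2 ^ treeHeight G v par v ≤ k * 2 ^ treeHeight G v par v :=
      Nat.mul_le_mul_right _ (by omega)
    omega
  · push Not at hall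
    obtain ⟨u, huv, hu⟩ := hall
    obtain ⟨D₁, hstep, hD₁⟩ := PebStep.of_adj (hp.adj huv) hu
    have hsum : ∀ f : V → ℕ, ∑ x, D₁ x * f x + 2 * f u = ∑ x, D x * f x + f (par u) := by
      intro f
      have := Finset.sum_congr (rfl : (univ : Finset V) = univ)
        fun x _ => congrArg (· * f x) (hD₁ x)
      simpa [add_mul, Finset.sum_add_distrib, ite_mul] using this
    have hcard := hsum fun _ => 1
    have hweight := hsum fun x => 2 ^ treeHeight G v par x
    simp only [mul_one] at hcard
    have hpow : 2 * 2 ^ treeHeight G v par u ≤ 2 ^ treeHeight G v par (par u) := by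
      rw [← pow_succ']
      exact Nat.pow_le_pow_right two_pos (hp.treeHeight_add_one_le huv)
    obtain ⟨D', hreach, hD'⟩ := ih _ (by omega) D₁ (by omega) rfl
    exact ⟨D', .head hstep hreach, hD'⟩

/-- A certificate that at most `k` pebbles can be moved onto `v`: here `p x` bounds the net number
of pebbles that can be moved from `x` to its parent. -/
def IsBarrier [Fintype V] (v : V) (par : V → V) (k : ℕ) (D p : V → ℕ) : Prop :=
  ∀ x, D x + ∑ c with c ≠ v ∧ par c = x, p c ≤ if x = v then k else 2 * p x + 1

theorem sum_children_add_ite [Fintype V] {v : V} {par : V → V} {u : V} (hu : u ≠ v) {p q : V → ℕ}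
    (h : ∀ y, q y = p y + if y = u then 1 else 0) (x : V) :
    ∑ c with c ≠ v ∧ par c = x, q c =
      ∑ c with c ≠ v ∧ par c = x, p c + if x = par u then 1 else 0 := by
  simp only [h, Finset.sum_add_distrib, Finset.sum_ite_eq']
  simp [hu.symm, eq_comm]

theorem IsBarrier.exists_of_pebStep [Fintype V] {G : SimpleGraph V} {v : V} {par : V → V}
    (hp : IsParentMap G v par) {k : ℕ} {D D' p : V → ℕ} (hB : IsBarrier v par k D p)
    (h : PebStep G D D') : ∃ p', IsBarrier v par k D' p' := by
  obtain ⟨u, w, huw, hu, hD⟩ := h.exists_adj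
  rcases hp.adj_cases huw with ⟨huv, rfl⟩ | ⟨hwv, rfl⟩
  · have hpu := hB u
    rw [if_neg huv] at hpu
    have hq : ∀ y, p y = (p y - if y = u then 1 else 0) + if y = u then 1 else 0 := by
      intro y
      by_cases hy : y = u
      · subst hy
        simp only [if_true]
        omega
      · simp [hy]
    refine ⟨fun y => p y - if y = u then 1 else 0, fun x => ?_⟩
    have h1 := sum_children_add_ite (par := par) huv hq x
    have h2 := hB x
    have h3 := hD x
    have h4 := hq x
    have h5 := huw.ne
    grind
  · refine ⟨fun y => p y + if y = w then 1 else 0, fun x => ?_⟩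
    have h1 := sum_children_add_ite (par := par) hwv
      (q := fun y => p y + if y = w then 1 else 0) (fun _ => rfl) x
    have h2 := hB x
    have h3 := hD x
    have h5 := huw.ne
    grind

theorem IsBarrier.le_of_pebReach [Fintype V] {G : SimpleGraph V} {v : V} {par : V → V}
    (hp : IsParentMap G v par) {k : ℕ} {D D' p : V → ℕ} (hB : IsBarrier v par k D p)
    (h : PebReach G D D') : D' v ≤ k := by
  have : ∃ p', IsBarrier v par k D' p' := by
    induction h with
    | refl => exact ⟨p, hB⟩
    | tail _ hs ih => exact ih.elim fun _ hB' => hB'.exists_of_pebStep hp hs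
  obtain ⟨p', hB'⟩ := this
  have := hB' v
  rw [if_pos rfl] at this
  omega

theorem IsBarrier.mono [Fintype V] {v : V} {par : V → V} {k : ℕ} {D D' p : V → ℕ}
    (hB : IsBarrier v par k D p) (h : ∀ x, D' x ≤ D x) : IsBarrier v par k D' p := fun x =>
  (Nat.add_le_add_right (h x) _).trans (hB x)

/-- An extremal distribution: the load arriving at each vertex is passed on to one highest child. -/
theorem IsParentMap.exists_isBarrier [Fintype V] {G : SimpleGraph V} {v : V} {par : V → V}
    (hp : IsParentMap G v par) (k : ℕ) :
    ∃ D p, IsBarrier v par k D p ∧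
      ∑ x, D x = k * 2 ^ treeHeight G v par v + ∑ x ∈ univ.erase v, 2 ^ treeHeight G v par x := by
  set h := treeHeight G v par with hh
  have hex : ∀ x, ∃ c, 0 < h x → c ≠ v ∧ par c = x ∧ h c + 1 = h x := fun x => by
    by_cases hx : 0 < h x
    · exact (hp.exists_child_of_treeHeight_pos hx).imp fun _ hc _ => hc
    · exact ⟨x, fun hx' => absurd hx' hx⟩
  choose heavy hheavy using hex
  obtain ⟨b, hbv, hb⟩ : ∃ b : V → ℕ, b v = k ∧
      ∀ x ≠ v, b x = 2 * (if x = heavy (par x) then b (par x) else 0) + 1 := by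
    let B : ℕ → V → ℕ := fun n => Nat.rec (fun _ => k)
      (fun _ g x => 2 * (if x = heavy (par x) then g (par x) else 0) + 1) n
    refine ⟨fun x => B (G.dist x v) x, by simp [B], fun x hx => ?_⟩
    simp only [← hp.dist_add_one hx, B]
  let p : V → ℕ := fun c => if c = heavy (par c) then b (par c) else 0
  let D : V → ℕ := fun x => if h x = 0 then b x else 0
  have hchild : ∀ x, ∑ c with c ≠ v ∧ par c = x, p c = if h x = 0 then 0 else b x := by
    intro x
    have h1 : ∑ c with c ≠ v ∧ par c = x, p c =
        ∑ c with c ≠ v ∧ par c = x, if c = heavy x then b x else 0 := by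
      refine Finset.sum_congr rfl fun c hc => ?_
      obtain ⟨-, -, rfl⟩ := Finset.mem_filter.1 hc
      rfl
    rw [h1, Finset.sum_ite_eq']
    by_cases hx : h x = 0
    · rw [if_pos hx, if_neg]
      intro hmem
      obtain ⟨-, hv, hpar⟩ := Finset.mem_filter.1 hmem
      have := hp.treeHeight_add_one_le hv
      rw [hpar, ← hh] at this
      omega
    · have := hheavy x (Nat.pos_of_ne_zero hx)
      rw [if_neg hx, if_pos (by simp [this.1, this.2.1])]
  have hload : ∀ x, D x + ∑ c with c ≠ v ∧ par c = x, p c = b x := by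
    intro x
    rw [hchild]
    by_cases hx : h x = 0 <;> simp [D, hx]
  have hbp : ∀ x ≠ v, b x = 2 * p x + 1 := hb
  refine ⟨D, p, fun x => ?_, ?_⟩
  · rw [hload]
    split_ifs with hx
    · rw [hx, hbv]
    · exact (hbp x hx).le
  · have h1 : ∑ x, D x = ∑ x, 2 ^ h x * D x := by
      refine Finset.sum_congr rfl fun x _ => ?_
      by_cases hx : h x = 0 <;> simp [D, hx]
    have h2 : ∑ x, 2 ^ h x * ∑ c with c ≠ v ∧ par c = x, p c =
        ∑ c ∈ univ.erase v, 2 ^ h c * (2 * p c) := by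
      have hfib : ∀ x, (univ.filter fun c => c ≠ v ∧ par c = x) =
          (univ.erase v).filter fun c => par c = x := by
        intro x
        ext c
        simp
      have : ∀ x, 2 ^ h x * ∑ c with c ≠ v ∧ par c = x, p c =
          ∑ c ∈ (univ.erase v).filter (fun c => par c = x), 2 ^ h (par c) * p c := by
        intro x
        rw [hfib, Finset.mul_sum]
        refine Finset.sum_congr rfl fun c hc => ?_
        rw [(Finset.mem_filter.1 hc).2]
      simp only [this]
      rw [Finset.sum_fiberwise]
      refine Finset.sum_congr rfl fun c hc => ?_
      by_cases hc' : c = heavy (par c)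
      · have hpos : 0 < h (par c) := by
          have := hp.treeHeight_add_one_le (Finset.ne_of_mem_erase hc)
          rw [← hh] at this
          omega
        have := (hheavy _ hpos).2.2
        rw [← hc'] at this
        rw [← this, pow_succ]
        ring
      · simp [p, hc']
    have h3 : ∑ x, 2 ^ h x * b x =
        2 ^ h v * k + ∑ x ∈ univ.erase v, 2 ^ h x * (2 * p x + 1) := by
      rw [← Finset.add_sum_erase _ _ (mem_univ v), hbv]
      congr 1
      exact Finset.sum_congr rfl fun x hx => by rw [hbp x (Finset.ne_of_mem_erase hx)]
    have h4 : ∑ x, 2 ^ h x * b x =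
        ∑ x, 2 ^ h x * D x + ∑ x, 2 ^ h x * ∑ c with c ≠ v ∧ par c = x, p c := by
      rw [← Finset.sum_add_distrib]
      exact Finset.sum_congr rfl fun x _ => by rw [← mul_add, hload]
    simp only [mul_add, mul_one, Finset.sum_add_distrib] at h3
    rw [mul_comm k]
    omega

theorem Finset.exists_le_sum_eq {ι : Type*} [DecidableEq ι] (s : Finset ι) (f : ι → ℕ) {n : ℕ}
    (hn : n ≤ ∑ i ∈ s, f i) : ∃ g : ι → ℕ, (∀ i, g i ≤ f i) ∧ ∑ i ∈ s, g i = n := by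
  induction n with
  | zero => exact ⟨0, fun _ => Nat.zero_le _, by simp⟩
  | succ n ih =>
    obtain ⟨g, hg, hsum⟩ := ih (by omega)
    obtain ⟨i, hi, hlt⟩ := Finset.exists_lt_of_sum_lt (hsum.trans_lt hn)
    refine ⟨fun j => g j + if j = i then 1 else 0, fun j => ?_, ?_⟩
    · by_cases hj : j = i
      · subst hj
        simpa using hlt
      · simpa [hj] using hg j
    · simp [Finset.sum_add_distrib, hsum, hi]

theorem IsParentMap.ftNum_eq [Fintype V] {G : SimpleGraph V} {v : V} {par : V → V}
    (hp : IsParentMap G v par) (k : ℕ) :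
    ftNum G v (k + 1) = k * 2 ^ treeHeight G v par v +
      ∑ x ∈ univ.erase v, 2 ^ treeHeight G v par x + 1 := by
  refine IsLeast.csInf_eq ⟨fun D hD => hp.exists_pebReach k D ?_, fun n hn => ?_⟩
  · have : ∑ x, D x ≤ ∑ x, D x * 2 ^ treeHeight G v par x :=
      Finset.sum_le_sum fun x _ => Nat.le_mul_of_pos_right _ (by positivity)
    omega
  · by_contra hlt
    obtain ⟨D, p, hB, hD⟩ := hp.exists_isBarrier k
    obtain ⟨D₀, hle, hsum⟩ := Finset.exists_le_sum_eq univ D (n := n) (by omega)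
    obtain ⟨D', hreach, hD'⟩ := hn D₀ hsum
    have := (hB.mono hle).le_of_pebReach hp hreach
    omega

/-- Moews' formula: if `(a₁, ..., aₙ)` is the nonincreasing length sequence of the
maximum path partition of the tree `T` rooted at `v`, then
`f_t(T,v) = t·2^{a₁} + Σ_{i≥2} (2^{aᵢ} - 1)`. -/
theorem t_pebbling_number_tree (T : SimpleGraph V) [Fintype V] (hT : T.IsTree) (v : V)
    (t : ℕ) (ht : 1 ≤ t) (P : PathSys T)
    (hP : IsMaxPartitionTo T (fun u => T.dist u v) P)
    (a₁ : ℕ) (rest : List ℕ) (hL : sortDesc (sysLengths P) = a₁ :: rest) :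
    ftNum T v t = t * 2 ^ a₁ + (rest.map fun a => 2 ^ a - 1).sum := by
  obtain ⟨par, hp⟩ := hT.exists_isParentMap v
  obtain ⟨k, rfl⟩ := Nat.exists_eq_add_of_le' ht
  have hperm : (sysLengths P).Perm (a₁ :: rest) := by
    rw [← hL]
    exact (List.perm_insertionSort _ _).symm
  rw [hp.ftNum_eq, hP.head_eq_treeHeight hT hp hL, hP.sum_two_pow_treeHeight hT hp,
    (hperm.map _).sum_eq, List.map_cons, List.sum_cons, add_mul, one_mul]
  have := Nat.one_le_two_pow (n := a₁)
  omega
end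

section
/- Let T be a tree, v a vertex, and t ≥ 1. For any path partition α of T⃗_v (the tree rooted at v with all edges directed toward v) with path lengths (a_1 ≥ a_2 ≥ ... ≥ a_n), set s_α = t·2^{a_1} + Σ_{i=2}^n 2^{a_i} − n + 1. Then f_t(T, v) = max over all path partitions α of s_α. -/
open SimpleGraph Finset

variable {V : Type*} [DecidableEq V]

/-- The quantity `s_α = t·2^{a₁} + Σ_{i≥2} (2^{aᵢ} - 1)` associated to a path
partition `α` with nonincreasing lengths `(a₁, ..., aₙ)`. -/
def sAlpha {G : SimpleGraph V} (t : ℕ) (P : PathSys G) : ℕ :=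
  match sortDesc (sysLengths P) with
  | [] => t
  | a :: rest => t * 2 ^ a + (rest.map fun b => 2 ^ b - 1).sum


/-- `p` is the parent function and `φ` the depth function of a tree `G` rooted at `v`. -/
structure IsRooting (G : SimpleGraph V) (v : V) (p : V → V) (φ : V → ℕ) : Prop where
  parent_root : p v = v
  depth_root : φ v = 0
  adj_parent : ∀ u, u ≠ v → G.Adj u (p u)
  depth_eq : ∀ u, u ≠ v → φ u = φ (p u) + 1
  eq_parent_or : ∀ a b, G.Adj a b → (a ≠ v ∧ p a = b) ∨ (b ≠ v ∧ p b = a)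

omit [DecidableEq V] in
lemma exists_isRooting {T : SimpleGraph V} (hT : T.IsTree) (v : V) :
    ∃ p, IsRooting T v p (fun u => T.dist u v) := by
  have key : ∀ u, ∃ w, (u = v → w = v) ∧
      (u ≠ v → T.Adj u w ∧ T.dist u v = T.dist w v + 1) := by
    intro u
    by_cases huv : u = v
    · exact ⟨v, fun _ => rfl, fun h => absurd huv h⟩
    · obtain ⟨w, hw⟩ := hT.connected.exists_walk_length_eq_dist u v
      cases w with
      | nil => exact absurd rfl huv
      | @cons _ b _ hab q =>
        refine ⟨b, fun h => absurd h huv, fun _ => ⟨hab, ?_⟩⟩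
        have h1 := SimpleGraph.dist_le q
        have h2 : T.dist u v ≤ T.dist u b + T.dist b v := hT.connected.dist_triangle
        rw [SimpleGraph.dist_eq_one_iff_adj.2 hab] at h2
        simp only [SimpleGraph.Walk.length_cons] at hw
        omega
  choose p hp0 hp1 using key
  have uniq : ∀ a b, T.Adj a b → T.dist a v = T.dist b v + 1 → p a = b := by
    intro a b hab hd
    have hav : a ≠ v := by
      rintro rfl
      simp at hd
    obtain ⟨h1, h2⟩ := hp1 a hav
    obtain ⟨w1, hw1⟩ := hT.connected.exists_walk_length_eq_dist (p a) v
    obtain ⟨w2, hw2⟩ := hT.connected.exists_walk_length_eq_dist b v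
    have e1 : (SimpleGraph.Walk.cons h1 w1).IsPath :=
      SimpleGraph.Walk.isPath_of_length_eq_dist _ (by simp [hw1, h2])
    have e2 : (SimpleGraph.Walk.cons hab w2).IsPath :=
      SimpleGraph.Walk.isPath_of_length_eq_dist _ (by simp [hw2, hd])
    have := (hT.isAcyclic.subsingleton_path a v).elim ⟨_, e1⟩ ⟨_, e2⟩
    have h3 := congrArg (fun q : T.Path a v => q.1.snd) this
    simpa using h3
  refine ⟨p, hp0 v rfl, by simp, fun u hu => (hp1 u hu).1, fun u hu => (hp1 u hu).2, ?_⟩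
  intro a b hab
  have h0 : T.dist a v ≠ T.dist b v := by
    rw [T.dist_comm (u := a), T.dist_comm (u := b)]
    exact hT.dist_ne_of_adj _ hab
  have h1 : T.dist a v ≤ T.dist a b + T.dist b v := hT.connected.dist_triangle
  have h2 : T.dist b v ≤ T.dist b a + T.dist a v := hT.connected.dist_triangle
  rw [SimpleGraph.dist_eq_one_iff_adj.2 hab] at h1
  rw [SimpleGraph.dist_eq_one_iff_adj.2 hab.symm] at h2
  rcases Nat.lt_or_gt_of_ne h0 with h | h
  · refine Or.inr ⟨?_, uniq b a hab.symm (by omega)⟩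
    rintro rfl
    simp at h
  · refine Or.inl ⟨?_, uniq a b hab (by omega)⟩
    rintro rfl
    simp at h

namespace IsRooting

omit [DecidableEq V] in
lemma parent_ne {G : SimpleGraph V} {v : V} {p : V → V} {φ : V → ℕ} (hR : IsRooting G v p φ)
    {u : V} (hu : u ≠ v) : p u ≠ u := (hR.adj_parent u hu).ne'

omit [DecidableEq V] in
lemma depth_parent {G : SimpleGraph V} {v : V} {p : V → V} {φ : V → ℕ}
    (hR : IsRooting G v p φ) (u : V) : φ (p u) = φ u - 1 := by
  by_cases hu : u = v
  · rw [hu, hR.parent_root, hR.depth_root]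
  · have := hR.depth_eq u hu
    omega

omit [DecidableEq V] in
lemma depth_iterate {G : SimpleGraph V} {v : V} {p : V → V} {φ : V → ℕ}
    (hR : IsRooting G v p φ) (j : ℕ) (x : V) : φ (p^[j] x) = φ x - j := by
  induction j with
  | zero => rfl
  | succ j ih =>
    rw [Function.iterate_succ_apply', hR.depth_parent, ih]
    omega

omit [DecidableEq V] in
lemma depth_eq_zero_iff {G : SimpleGraph V} {v : V} {p : V → V} {φ : V → ℕ}
    (hR : IsRooting G v p φ) {u : V} : φ u = 0 ↔ u = v := by
  constructor
  · intro h
    by_contra hu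
    have := hR.depth_eq u hu
    omega
  · rintro rfl
    exact hR.depth_root

omit [DecidableEq V] in
lemma iterate_depth {G : SimpleGraph V} {v : V} {p : V → V} {φ : V → ℕ}
    (hR : IsRooting G v p φ) (x : V) : p^[φ x] x = v := by
  rw [← hR.depth_eq_zero_iff, hR.depth_iterate, Nat.sub_self]

end IsRooting

/-- `F` bounds the number of pebbles that `D` can deliver to each vertex of a tree with root `v`
and parent function `p`, when all moves are made towards the root. -/
def IsCert [Fintype V] (v : V) (p : V → V) (F D : V → ℕ) : Prop :=
  ∀ u, D u + ∑ c ∈ univ.filter (fun c => c ≠ v ∧ p c = u), F c / 2 ≤ F u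

lemma IsCert.of_step [Fintype V] {G : SimpleGraph V} {v : V} {p : V → V} {φ : V → ℕ}
    (hR : IsRooting G v p φ) {D D' F : V → ℕ} (hF : IsCert v p F D) (h : PebStep G D D') :
    ∃ F', IsCert v p F' D' ∧ F' v ≤ F v := by
  obtain ⟨a, b, hab, h2, rfl⟩ := h
  rcases hR.eq_parent_or a b hab with ⟨hav, rfl⟩ | ⟨hbv, rfl⟩
  · have hFa : 2 ≤ F a := by
      have := hF a
      omega
    refine ⟨fun x => if x = a then F a - 2 else F x, ?_, by simp [hav.symm]⟩
    intro w
    have hw := hF w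
    have hle : ∀ c, (if c = a then F a - 2 else F c) / 2 ≤ F c / 2 := by
      intro c
      split_ifs with hc
      · subst hc; omega
      · rfl
    by_cases hwa : w = a
    · subst hwa
      have : ∑ c ∈ univ.filter (fun c => c ≠ v ∧ p c = w), (if c = w then F w - 2 else F c) / 2
          ≤ ∑ c ∈ univ.filter (fun c => c ≠ v ∧ p c = w), F c / 2 :=
        Finset.sum_le_sum fun c _ => hle c
      simp only [if_true]
      omega
    · by_cases hwb : w = p a
      · subst hwb
        have hmem : a ∈ univ.filter (fun c => c ≠ v ∧ p c = p a) := by simp [hav]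
        rw [← Finset.add_sum_erase _ _ hmem] at hw ⊢
        have : ∑ c ∈ (univ.filter (fun c => c ≠ v ∧ p c = p a)).erase a,
              (if c = a then F a - 2 else F c) / 2
            ≤ ∑ c ∈ (univ.filter (fun c => c ≠ v ∧ p c = p a)).erase a, F c / 2 :=
          Finset.sum_le_sum fun c _ => hle c
        simp only [hwa, if_true, if_false]
        omega
      · have : ∑ c ∈ univ.filter (fun c => c ≠ v ∧ p c = w), (if c = a then F a - 2 else F c) / 2
            ≤ ∑ c ∈ univ.filter (fun c => c ≠ v ∧ p c = w), F c / 2 :=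
          Finset.sum_le_sum fun c _ => hle c
        simp only [hwa, hwb, if_false]
        omega
  · have hne : p b ≠ b := hR.parent_ne hbv
    have hFa : 2 ≤ F (p b) := by
      have := hF (p b)
      omega
    refine ⟨fun x => if x = b then F b + 1 else if x = p b then F (p b) - 1 else F x, ?_, ?_⟩
    · intro w
      have hw := hF w
      have hle : ∀ c, c ≠ b →
          (if c = b then F b + 1 else if c = p b then F (p b) - 1 else F c) / 2 ≤ F c / 2 := by
        intro c hc
        rw [if_neg hc]
        split_ifs with hc
        · subst hc; omega
        · rfl
      by_cases hwp : w = p b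
      · subst hwp
        have hmem : b ∈ univ.filter (fun c => c ≠ v ∧ p c = p b) := by simp [hbv]
        rw [← Finset.add_sum_erase _ _ hmem] at hw ⊢
        have : ∑ c ∈ (univ.filter (fun c => c ≠ v ∧ p c = p b)).erase b,
              (if c = b then F b + 1 else if c = p b then F (p b) - 1 else F c) / 2
            ≤ ∑ c ∈ (univ.filter (fun c => c ≠ v ∧ p c = p b)).erase b, F c / 2 :=
          Finset.sum_le_sum fun c hc => hle c (Finset.ne_of_mem_erase hc)
        simp only [hne, if_true, if_false]
        omega
      · have : ∑ c ∈ univ.filter (fun c => c ≠ v ∧ p c = w),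
              (if c = b then F b + 1 else if c = p b then F (p b) - 1 else F c) / 2
            ≤ ∑ c ∈ univ.filter (fun c => c ≠ v ∧ p c = w), F c / 2 := by
          refine Finset.sum_le_sum fun c hc => hle c ?_
          rintro rfl
          simp only [Finset.mem_filter] at hc
          exact hwp hc.2.2.symm
        simp only [hwp, if_false]
        split_ifs with h
        · subst h; omega
        · omega
    · beta_reduce
      rw [if_neg hbv.symm]
      split_ifs with h
      · rw [h]; omega
      · rfl

lemma IsCert.le_of_reach [Fintype V] {G : SimpleGraph V} {v : V} {p : V → V} {φ : V → ℕ}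
    (hR : IsRooting G v p φ) {D D' F : V → ℕ} (hF : IsCert v p F D) (h : PebReach G D D') :
    D' v ≤ F v := by
  have key : ∃ F', IsCert v p F' D' ∧ F' v ≤ F v := by
    induction h with
    | refl => exact ⟨F, hF, le_rfl⟩
    | tail _ hs ih =>
      obtain ⟨F1, h1, h1'⟩ := ih
      obtain ⟨F2, h2, h2'⟩ := h1.of_step hR hs
      exact ⟨F2, h2, h2'.trans h1'⟩
  obtain ⟨F', h1, h2⟩ := key
  have := h1 v
  omega

lemma exists_isCert [Fintype V] {G : SimpleGraph V} {v : V} {p : V → V} {φ : V → ℕ}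
    (hR : IsRooting G v p φ) {t : ℕ} (D : V → ℕ) (hD : ∀ D', PebReach G D D' → D' v < t) :
    ∃ F, IsCert v p F D ∧ F v < t := by
  induction hn : ∑ x, D x using Nat.strong_induction_on generalizing D with
  | _ n ih =>
    by_cases hc : ∃ c, c ≠ v ∧ 2 ≤ D c
    · obtain ⟨c, hcv, h2⟩ := hc
      have hne : p c ≠ c := hR.parent_ne hcv
      set D' : V → ℕ := fun x => if x = c then D c - 2 else if x = p c then D (p c) + 1 else D x
        with hD'
      have hstep : PebStep G D D' := ⟨c, p c, hR.adj_parent c hcv, h2, rfl⟩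
      have hsum : ∑ x, D' x < n := by
        have hm : p c ∈ (univ : Finset V).erase c := by simp [hne]
        rw [← hn, ← Finset.add_sum_erase univ D' (Finset.mem_univ c),
          ← Finset.add_sum_erase univ D (Finset.mem_univ c),
          ← Finset.add_sum_erase _ D' hm, ← Finset.add_sum_erase _ D hm]
        have : ∑ x ∈ (univ.erase c).erase (p c), D' x = ∑ x ∈ (univ.erase c).erase (p c), D x := by
          refine Finset.sum_congr rfl fun x hx => ?_
          simp only [Finset.mem_erase] at hx
          simp [hD', hx.1, hx.2.1]
        rw [this]
        simp only [hD', hne, if_true, if_false]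
        omega
      obtain ⟨F', hF', hv⟩ := ih _ hsum D'
        (fun E hE => hD E (Relation.ReflTransGen.head hstep hE)) rfl
      refine ⟨fun x => if x = c then F' c + 2 else F' x, ?_, by simpa [hcv.symm] using hv⟩
      intro w
      have hw := hF' w
      by_cases hwp : w = p c
      · subst hwp
        have hmem : c ∈ univ.filter (fun x => x ≠ v ∧ p x = p c) := by simp [hcv]
        rw [← Finset.add_sum_erase _ _ hmem] at hw ⊢
        have : ∑ x ∈ (univ.filter (fun x => x ≠ v ∧ p x = p c)).erase c,
              (if x = c then F' c + 2 else F' x) / 2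
            = ∑ x ∈ (univ.filter (fun x => x ≠ v ∧ p x = p c)).erase c, F' x / 2 :=
          Finset.sum_congr rfl fun x hx => by rw [if_neg (Finset.ne_of_mem_erase hx)]
        simp only [hD', hne, if_true, if_false] at hw ⊢
        omega
      · have : ∑ x ∈ univ.filter (fun x => x ≠ v ∧ p x = w),
              (if x = c then F' c + 2 else F' x) / 2
            = ∑ x ∈ univ.filter (fun x => x ≠ v ∧ p x = w), F' x / 2 := by
          refine Finset.sum_congr rfl fun x hx => ?_
          rw [if_neg]
          rintro rfl
          simp only [Finset.mem_filter] at hx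
          exact hwp hx.2.2.symm
        simp only [hD', hwp, if_false] at hw ⊢
        split_ifs with h
        · subst h
          simp only [if_true] at hw
          omega
        · rw [if_neg h] at hw
          omega
    · push Not at hc
      refine ⟨D, fun u => ?_, hD D Relation.ReflTransGen.refl⟩
      rw [Finset.sum_eq_zero, add_zero]
      intro c hc'
      simp only [Finset.mem_filter] at hc'
      have := hc c hc'.2.1
      omega

/-- If `h` increases by at least one from each vertex to its parent, a certificate bounds the
total number of pebbles. -/
lemma IsCert.sum_le [Fintype V] {v : V} {p : V → V} {h F D : V → ℕ} (hF : IsCert v p F D)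
    (hh : ∀ c, c ≠ v → h c + 1 ≤ h (p c)) :
    ∑ u, D u ≤ F v * 2 ^ h v + ∑ c ∈ univ.erase v, 2 ^ h c := by
  have loc : ∀ u, D u + ∑ c ∈ univ.filter (fun c => c ≠ v ∧ p c = u), F c * 2 ^ h c
      ≤ F u * 2 ^ h u + ∑ c ∈ univ.filter (fun c => c ≠ v ∧ p c = u), 2 ^ h c := by
    intro u
    have h1 : ∑ c ∈ univ.filter (fun c => c ≠ v ∧ p c = u), F c * 2 ^ h c
        ≤ ∑ c ∈ univ.filter (fun c => c ≠ v ∧ p c = u), (F c / 2 * 2 ^ h u + 2 ^ h c) := by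
      refine Finset.sum_le_sum fun c hc => ?_
      simp only [Finset.mem_filter] at hc
      obtain ⟨-, hcv, rfl⟩ := hc
      calc F c * 2 ^ h c ≤ (2 * (F c / 2) + 1) * 2 ^ h c := Nat.mul_le_mul_right _ (by omega)
        _ = F c / 2 * 2 ^ (h c + 1) + 2 ^ h c := by ring
        _ ≤ _ := by
          gcongr
          · norm_num
          · exact hh c hcv
    rw [Finset.sum_add_distrib, ← Finset.sum_mul] at h1
    have h2 := Nat.mul_le_mul_right (2 ^ h u) (hF u)
    rw [add_mul] at h2
    have h3 : D u ≤ D u * 2 ^ h u := Nat.le_mul_of_pos_right _ (by positivity)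
    omega
  have fib : ∀ f : V → ℕ, ∑ u, ∑ c ∈ univ.filter (fun c => c ≠ v ∧ p c = u), f c
      = ∑ c ∈ univ.erase v, f c := by
    intro f
    rw [← Finset.sum_fiberwise (univ.erase v) p f]
    refine Finset.sum_congr rfl fun u _ => Finset.sum_congr ?_ fun _ _ => rfl
    ext c
    simp
  have tot := Finset.sum_le_sum fun u (_ : u ∈ univ) => loc u
  rw [Finset.sum_add_distrib, Finset.sum_add_distrib, fib, fib (fun c => 2 ^ h c),
    ← Finset.add_sum_erase univ (fun u => F u * 2 ^ h u) (Finset.mem_univ v)] at tot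
  omega

lemma isCert_chain [Fintype V] {G : SimpleGraph V} {v : V} {p : V → V} {φ : V → ℕ}
    (hR : IsRooting G v p φ) (x : V) (g : ℕ → ℕ) (hg : ∀ i < φ x, g (i + 1) / 2 ≤ g i) :
    IsCert v p (fun u => if p^[φ x - φ u] x = u then g (φ u) else 0)
      (fun u => if u = x then g (φ x) else 0) := by
  intro u
  by_cases hc : ∃ c, (c ≠ v ∧ p c = u) ∧ p^[φ x - φ c] x = c
  · obtain ⟨c, ⟨hcv, rfl⟩, hcx⟩ := hc
    have hd := hR.depth_eq c hcv
    have hle : φ c ≤ φ x := by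
      have := hR.depth_iterate (φ x - φ c) x
      rw [hcx] at this
      omega
    have hne : p c ≠ x := by
      rintro rfl
      omega
    have hpc : p^[φ x - φ (p c)] x = p c := by
      have : φ x - φ (p c) = (φ x - φ c) + 1 := by omega
      rw [this, Function.iterate_succ_apply', hcx]
    rw [Finset.sum_eq_single_of_mem c (by simp [hcv])]
    · simp only [hne, hcx, hpc, if_true, if_false, zero_add]
      rw [hd]
      exact hg _ (by omega)
    · intro b hb hbc
      simp only [Finset.mem_filter] at hb
      beta_reduce
      rw [if_neg, Nat.zero_div]
      intro hbx
      have := hR.depth_eq b hb.2.1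
      rw [hb.2.2] at this
      rw [show φ b = φ c by omega, hcx] at hbx
      exact hbc hbx.symm
  · push Not at hc
    rw [Finset.sum_eq_zero]
    · by_cases hux : u = x
      · subst hux
        simp
      · simp [hux]
    · intro c hcm
      simp only [Finset.mem_filter] at hcm
      simp [hc c hcm.2]

lemma IsCert.add [Fintype V] {v : V} {p : V → V} {F₁ F₂ D₁ D₂ : V → ℕ}
    (h₁ : IsCert v p F₁ D₁) (h₂ : IsCert v p F₂ D₂)
    (hd : ∀ c, c ≠ v → (F₁ c + F₂ c) / 2 = F₁ c / 2 + F₂ c / 2) :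
    IsCert v p (fun u => F₁ u + F₂ u) (fun u => D₁ u + D₂ u) := by
  intro u
  have e : ∑ c ∈ univ.filter (fun c => c ≠ v ∧ p c = u), (F₁ c + F₂ c) / 2
      = ∑ c ∈ univ.filter (fun c => c ≠ v ∧ p c = u), F₁ c / 2
        + ∑ c ∈ univ.filter (fun c => c ≠ v ∧ p c = u), F₂ c / 2 := by
    rw [← Finset.sum_add_distrib]
    refine Finset.sum_congr rfl fun c hc => hd c ?_
    simp only [Finset.mem_filter] at hc
    exact hc.2.1
  have := h₁ u
  have := h₂ u
  simp only [e]
  omega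

omit [DecidableEq V] in
lemma IsRooting.walk_spec {G : SimpleGraph V} {v : V} {p : V → V} {φ : V → ℕ}
    (hR : IsRooting G v p φ) {a b : V} (w : G.Walk a b)
    (hw : ∀ d ∈ w.darts, φ d.snd < φ d.fst) :
    w.length ≤ φ a ∧ ∀ j < w.length, s(p^[j] a, p (p^[j] a)) ∈ w.edges := by
  induction w with
  | nil => simp
  | @cons a c b hac w ih =>
    have h0 : φ c < φ a := hw ⟨(a, c), hac⟩ (by simp)
    have hpa : p a = c := by
      rcases hR.eq_parent_or a c hac with h | ⟨hc, h⟩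
      · exact h.2
      · have := hR.depth_eq c hc
        rw [h] at this
        omega
    obtain ⟨h1, h2⟩ := ih fun d hd => hw d (by simp [hd])
    refine ⟨by simp only [SimpleGraph.Walk.length_cons]; omega, ?_⟩
    intro j hj
    cases j with
    | zero => simp [hpa]
    | succ j =>
      have := h2 j (by simpa using hj)
      rw [Function.iterate_succ_apply, hpa, SimpleGraph.Walk.edges_cons]
      exact List.mem_cons_of_mem _ this

lemma exists_isCert_pathsExtra [Fintype V] {G : SimpleGraph V} {v : V} {p : V → V} {φ : V → ℕ}
    (hR : IsRooting G v p φ) (P : PathSys G)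
    (hP : ∀ q ∈ P, ∀ d ∈ q.2.2.darts, φ d.snd < φ d.fst)
    (hdisj : P.Pairwise (fun q r => ∀ e ∈ q.2.2.edges, e ∉ r.2.2.edges)) :
    ∃ F D, IsCert v p F D ∧ ∑ u, D u = pathsExtra P ∧
      ∀ u, F u ≠ 0 → u ≠ v ∧ ∃ q ∈ P, s(u, p u) ∈ q.2.2.edges := by
  induction P with
  | nil => exact ⟨fun _ => 0, fun _ => 0, fun u => by simp, by simp [pathsExtra, sysLengths],
      fun u h => absurd rfl h⟩
  | cons q P ih =>
    rw [List.pairwise_cons] at hdisj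
    obtain ⟨F, D, hF, hD, hs⟩ := ih (fun r hr => hP r (List.mem_cons_of_mem _ hr)) hdisj.2
    obtain ⟨a, b, w⟩ := q
    obtain ⟨hlen, hedge⟩ := hR.walk_spec w (hP ⟨a, b, w⟩ (by simp))
    have hC := isCert_chain hR a (fun i => 2 ^ (i - (φ a - w.length)) - 1) (by
      intro i _
      have h1 : i + 1 - (φ a - w.length) ≤ (i - (φ a - w.length)) + 1 := by omega
      have h2 := Nat.pow_le_pow_right (n := 2) (by norm_num) h1
      rw [pow_succ] at h2
      omega)
    set F₁ : V → ℕ := fun u => if p^[φ a - φ u] a = u then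
      2 ^ (φ u - (φ a - w.length)) - 1 else 0 with hF₁
    have hs₁ : ∀ u, F₁ u ≠ 0 → u ≠ v ∧ s(u, p u) ∈ w.edges := by
      intro u hu
      simp only [hF₁] at hu
      split_ifs at hu with h
      · have h3 : φ u - (φ a - w.length) ≠ 0 := by
          intro h0
          simp [h0] at hu
        have h4 := hR.depth_iterate (φ a - φ u) a
        rw [h] at h4
        have h5 := hedge (φ a - φ u) (by omega)
        rw [h] at h5
        refine ⟨?_, h5⟩
        rintro rfl
        rw [hR.depth_root] at h3
        omega
      · exact absurd rfl hu
    refine ⟨_, _, hC.add hF ?_, ?_, ?_⟩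
    · intro c _
      by_cases h1 : F₁ c = 0
      · simp [h1]
      · have h2 : F c = 0 := by
          by_contra h2
          obtain ⟨-, r, hr, hr'⟩ := hs c h2
          exact hdisj.1 r hr _ (hs₁ c h1).2 hr'
        simp [h2]
    · rw [Finset.sum_add_distrib, hD]
      simp [pathsExtra, sysLengths, Nat.sub_sub_self hlen]
    · intro u hu
      by_cases h1 : F₁ u = 0
      · obtain ⟨h2, r, hr, hr'⟩ := hs u (by simpa [h1] using hu)
        exact ⟨h2, r, List.mem_cons_of_mem _ hr, hr'⟩
      · exact ⟨(hs₁ u h1).1, _, List.mem_cons_self, (hs₁ u h1).2⟩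

lemma exists_isCert_pathsExtra_add [Fintype V] {G : SimpleGraph V} {v : V} {p : V → V} {φ : V → ℕ}
    (hR : IsRooting G v p φ) (P : PathSys G)
    (hP : ∀ q ∈ P, ∀ d ∈ q.2.2.darts, φ d.snd < φ d.fst)
    (hdisj : P.Pairwise (fun q r => ∀ e ∈ q.2.2.edges, e ∉ r.2.2.edges)) (m : ℕ) (x : V) :
    ∃ F D, IsCert v p F D ∧ ∑ u, D u = pathsExtra P + m * 2 ^ φ x ∧ F v = m := by
  obtain ⟨F, D, hF, hD, hs⟩ := exists_isCert_pathsExtra hR P hP hdisj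
  have hC := isCert_chain hR x (fun i => m * 2 ^ i) (by
    intro i _
    have : m * 2 ^ (i + 1) = m * 2 ^ i * 2 := by ring
    simp [this])
  refine ⟨_, _, hF.add hC ?_, ?_, ?_⟩
  · intro c hc
    split_ifs
    · rw [hR.depth_eq c hc, show m * 2 ^ (φ (p c) + 1) = m * 2 ^ φ (p c) * 2 by ring]
      omega
    · rfl
  · rw [Finset.sum_add_distrib, hD]
    simp
  · have h0 : F v = 0 := by
      by_contra h
      exact (hs v h).1 rfl
    simp [h0, hR.depth_root, hR.iterate_depth]

lemma exists_le_sum_eq [Fintype V] (D : V → ℕ) {n : ℕ} (hn : n ≤ ∑ x, D x) :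
    ∃ D' : V → ℕ, (∀ x, D' x ≤ D x) ∧ ∑ x, D' x = n := by
  induction n with
  | zero => exact ⟨fun _ => 0, by simp, by simp⟩
  | succ n ih =>
    obtain ⟨D', h1, h2⟩ := ih (by omega)
    obtain ⟨x, -, hx⟩ := Finset.exists_lt_of_sum_lt (s := univ) (f := D') (g := D) (by omega)
    refine ⟨fun y => D' y + if y = x then 1 else 0, fun y => ?_, ?_⟩
    · have := h1 y
      beta_reduce
      split_ifs with h
      · subst h; omega
      · omega
    · rw [Finset.sum_add_distrib, h2]
      simp

omit [DecidableEq V] in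
lemma exists_sAlpha_eq {G : SimpleGraph V} {t : ℕ} (ht : 1 ≤ t) (P : PathSys G) :
    ∃ a, (a = 0 ∨ a ∈ sysLengths P) ∧ sAlpha t P = pathsExtra P + (t - 1) * 2 ^ a + 1 := by
  have hperm : (sortDesc (sysLengths P)).Perm (sysLengths P) := List.perm_insertionSort _ _
  have hsum : pathsExtra P = ((sortDesc (sysLengths P)).map fun a => 2 ^ a - 1).sum :=
    ((hperm.map _).sum_eq).symm
  rw [hsum, sAlpha]
  cases hl : sortDesc (sysLengths P) with
  | nil => exact ⟨0, Or.inl rfl, by simp; omega⟩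
  | cons a l =>
    refine ⟨a, Or.inr (hperm.mem_iff.1 (by simp [hl])), ?_⟩
    obtain ⟨s, rfl⟩ := Nat.exists_eq_add_of_le' ht
    have : 1 ≤ 2 ^ a := Nat.one_le_two_pow
    simp only [List.map_cons, List.sum_cons, Nat.add_sub_cancel, add_mul]
    omega

omit [DecidableEq V] in
lemma le_sAlpha {G : SimpleGraph V} {t : ℕ} (ht : 1 ≤ t) (P : PathSys G) {a : ℕ}
    (ha : a = 0 ∨ a ∈ sysLengths P) : pathsExtra P + (t - 1) * 2 ^ a + 1 ≤ sAlpha t P := by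
  have hperm : (sortDesc (sysLengths P)).Perm (sysLengths P) := List.perm_insertionSort _ _
  have hsort : (sortDesc (sysLengths P)).Pairwise (· ≥ ·) := List.pairwise_insertionSort _ _
  have hsum : pathsExtra P = ((sortDesc (sysLengths P)).map fun a => 2 ^ a - 1).sum :=
    ((hperm.map _).sum_eq).symm
  rw [← hperm.mem_iff] at ha
  rw [hsum, sAlpha]
  cases hl : sortDesc (sysLengths P) with
  | nil =>
    rw [hl] at ha
    have : a = 0 := by simpa using ha
    subst this
    simp
    omega
  | cons b l =>
    rw [hl] at ha hsort
    rw [List.pairwise_cons] at hsort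
    have hab : a ≤ b := by
      rcases ha with rfl | ha
      · exact Nat.zero_le _
      · rcases List.mem_cons.1 ha with rfl | h
        · rfl
        · exact hsort.1 _ h
    obtain ⟨s, rfl⟩ := Nat.exists_eq_add_of_le' ht
    have h1 : 1 ≤ 2 ^ b := Nat.one_le_two_pow
    have h2 : s * 2 ^ a ≤ s * 2 ^ b :=
      Nat.mul_le_mul_left _ (Nat.pow_le_pow_right (by norm_num) hab)
    simp only [List.map_cons, List.sum_cons, Nat.add_sub_cancel, add_mul]
    omega

lemma sAlpha_le_of_solvable [Fintype V] {G : SimpleGraph V} {v : V} {p : V → V} {φ : V → ℕ}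
    (hR : IsRooting G v p φ) {t : ℕ} (ht : 1 ≤ t) {P : PathSys G} (hP : IsPartitionTo G φ P)
    {N : ℕ} (hN : ∀ D : V → ℕ, (∑ x, D x) = N → ∃ D', PebReach G D D' ∧ t ≤ D' v) :
    sAlpha t P ≤ N := by
  by_contra! hlt
  obtain ⟨a, ha, hs⟩ := exists_sAlpha_eq ht P
  have hdec : ∀ q ∈ P, ∀ d ∈ q.2.2.darts, φ d.snd < φ d.fst := fun q hq => (hP.1 q hq).2.2
  have hx : ∃ x, a ≤ φ x := by
    rcases ha with rfl | ha
    · exact ⟨v, Nat.zero_le _⟩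
    · obtain ⟨q, hq, rfl⟩ := List.mem_map.1 ha
      exact ⟨q.1, (hR.walk_spec q.2.2 (hdec q hq)).1⟩
  obtain ⟨x, hx⟩ := hx
  obtain ⟨F, D, hF, hD, hv⟩ := exists_isCert_pathsExtra_add hR P hdec hP.2.1 (t - 1) x
  have hle : (t - 1) * 2 ^ a ≤ (t - 1) * 2 ^ φ x :=
    Nat.mul_le_mul_left _ (Nat.pow_le_pow_right (by norm_num) hx)
  obtain ⟨E, hE, hEN⟩ := exists_le_sum_eq D (n := N) (by omega)
  obtain ⟨E', hr, ht'⟩ := hN E hEN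
  have hFE : IsCert v p F E := fun u => (Nat.add_le_add_right (hE u) _).trans (hF u)
  have := hFE.le_of_reach hR hr
  omega

omit [DecidableEq V] in
/-- A consistent choice of a deepest descendant `l u` of every vertex `u`. -/
lemma exists_deepest_descendant [Fintype V] (p : V → V) (φ : V → ℕ) :
    ∃ l : V → V, (∀ u, ∃ j, p^[j] (l u) = u) ∧ (∀ x j, φ x ≤ φ (l (p^[j] x))) ∧
      ∀ u i j, p^[j] (l (p^[i] u)) = u → l u = l (p^[i] u) := by
  classical
  let κ : V → ℕ ×ₗ Fin (Fintype.card V) := fun x => toLex (φ x, Fintype.equivFin V x)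
  have hκ : Function.Injective κ := by
    intro x y h
    have h' := congrArg (fun z => (ofLex z).2) h
    exact (Fintype.equivFin V).injective h'
  have hκφ : ∀ x y, κ x ≤ κ y → φ x ≤ φ y := by
    intro x y h
    rcases Prod.Lex.toLex_le_toLex.1 h with h | h
    · exact h.le
    · exact h.1.le
  have key : ∀ u, ∃ x, (∃ j, p^[j] x = u) ∧ ∀ y, (∃ j, p^[j] y = u) → κ y ≤ κ x := by
    intro u
    obtain ⟨x, hx, hmax⟩ := Finset.exists_max_image
      (univ.filter fun x => ∃ j, p^[j] x = u) κ ⟨u, by simpa using ⟨0, rfl⟩⟩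
    simp only [Finset.mem_filter, Finset.mem_univ, true_and] at hx hmax
    exact ⟨x, hx, hmax⟩
  choose l hl hmax using key
  refine ⟨l, hl, fun x j => hκφ _ _ (hmax _ x ⟨j, rfl⟩), ?_⟩
  intro u i j hj
  refine hκ (le_antisymm (hmax _ _ ?_) (hmax _ _ ⟨j, hj⟩))
  obtain ⟨m, hm⟩ := hl u
  exact ⟨i + m, by rw [Function.iterate_add_apply, hm]⟩

omit [DecidableEq V] in
lemma IsRooting.exists_walk {G : SimpleGraph V} {v : V} {p : V → V} {φ : V → ℕ}
    (hR : IsRooting G v p φ) (k : ℕ) (x : V) (hk : k ≤ φ x) :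
    ∃ (b : V) (w : G.Walk x b), w.IsPath ∧ w.length = k ∧ (∀ y ∈ w.support, φ y ≤ φ x) ∧
      (∀ d ∈ w.darts, φ d.snd < φ d.fst) ∧
      ∀ e ∈ w.edges, ∃ j < k, e = s(p^[j] x, p (p^[j] x)) := by
  induction k generalizing x with
  | zero => exact ⟨x, SimpleGraph.Walk.nil, by simp⟩
  | succ k ih =>
    have hxv : x ≠ v := by
      rintro rfl
      rw [hR.depth_root] at hk
      omega
    have hd := hR.depth_eq x hxv
    obtain ⟨b, w, h1, h2, h3, h4, h5⟩ := ih (p x) (by omega)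
    refine ⟨b, SimpleGraph.Walk.cons (hR.adj_parent x hxv) w, ?_, ?_, ?_, ?_, ?_⟩
    · refine h1.cons fun hx => ?_
      have := h3 x hx
      omega
    · simp [h2]
    · intro y hy
      rw [SimpleGraph.Walk.support_cons, List.mem_cons] at hy
      rcases hy with rfl | hy
      · rfl
      · have := h3 y hy
        omega
    · intro d hdm
      rw [SimpleGraph.Walk.darts_cons, List.mem_cons] at hdm
      rcases hdm with rfl | hdm
      · change φ (p x) < φ x
        omega
      · exact h4 d hdm
    · intro e he
      rw [SimpleGraph.Walk.edges_cons, List.mem_cons] at he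
      rcases he with rfl | he
      · exact ⟨0, by omega, rfl⟩
      · obtain ⟨j, hj, rfl⟩ := h5 e he
        exact ⟨j + 1, by omega, rfl⟩

omit [DecidableEq V] in
lemma IsRooting.eq_of_edge_eq {G : SimpleGraph V} {v : V} {p : V → V} {φ : V → ℕ}
    (hR : IsRooting G v p φ) {a b : V} (ha : a ≠ v) (hb : b ≠ v)
    (h : s(a, p a) = s(b, p b)) : a = b := by
  rcases Sym2.eq_iff.1 h with h | ⟨h1, h2⟩
  · exact h.1
  · have e1 := hR.depth_eq a ha
    have e2 := hR.depth_eq b hb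
    rw [h2] at e1
    rw [← h1] at e2
    omega

/-- The decomposition of a rooted tree into its heavy paths. -/
lemma exists_partition_of_isRooting [Fintype V] {G : SimpleGraph V} {v : V} {p : V → V}
    {φ : V → ℕ} (hR : IsRooting G v p φ) :
    ∃ (P : PathSys G) (h : V → ℕ), IsPartitionTo G φ P ∧ (∀ c, c ≠ v → h c + 1 ≤ h (p c)) ∧
      ∑ c ∈ univ.erase v, 2 ^ h c ≤ pathsExtra P ∧ (h v = 0 ∨ h v ∈ sysLengths P) := by
  obtain ⟨l, hdesc, hmax, hmono⟩ := exists_deepest_descendant p φ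
  have hle : ∀ u, φ u ≤ φ (l u) := fun u => hmax u 0
  have hanc : ∀ u, p^[φ (l u) - φ u] (l u) = u := by
    intro u
    obtain ⟨j, hj⟩ := hdesc u
    by_cases hjl : j ≤ φ (l u)
    · have := hR.depth_iterate j (l u)
      rw [hj] at this
      rwa [show φ (l u) - φ u = j by omega]
    · have hφ := hR.depth_iterate j (l u)
      rw [hj] at hφ
      have hu : u = v := hR.depth_eq_zero_iff.1 (by omega)
      rw [hu, hR.depth_root, Nat.sub_zero, hR.iterate_depth]
  have hll : ∀ u, l (l u) = l u := by
    intro u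
    have := hmono (l u) (φ (l u) - φ u) 0
    rw [hanc] at this
    exact this rfl
  have hpos : ∀ u, u ≠ v → l u ≠ v := by
    intro u hu h
    have h1 := hle u
    rw [h, hR.depth_root] at h1
    exact hu (hR.depth_eq_zero_iff.1 (by omega))
  have hk : ∀ x, ∃ k ≤ φ x, ∀ j < φ x, j < k ↔ l (p^[j] x) = x := by
    intro x
    have hex : ∃ j, φ x ≤ j ∨ l (p^[j] x) ≠ x := ⟨φ x, Or.inl le_rfl⟩
    refine ⟨Nat.find hex, Nat.find_min' hex (Or.inl le_rfl), fun j hj => ⟨fun h => ?_, ?_⟩⟩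
    · have := Nat.find_min hex h
      push Not at this
      exact this.2
    · intro h
      by_contra! hkj
      rcases Nat.find_spec hex with h' | h'
      · omega
      · apply h'
        have := hmono (p^[Nat.find hex] x) (j - Nat.find hex) (Nat.find hex)
        rw [← Function.iterate_add_apply, Nat.sub_add_cancel hkj, h] at this
        exact this rfl
  choose k hkle hk using hk
  have hq : ∀ x, ∃ q : Σ a : V, Σ b : V, G.Walk a b, q.2.2.IsPath ∧ q.2.2.length = k x ∧
      (∀ d ∈ q.2.2.darts, φ d.snd < φ d.fst) ∧
      ∀ e, e ∈ q.2.2.edges ↔ ∃ j < k x, e = s(p^[j] x, p (p^[j] x)) := by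
    intro x
    obtain ⟨b, w, h1, h2, -, h4, h5⟩ := hR.exists_walk (k x) x (hkle x)
    refine ⟨⟨x, b, w⟩, h1, h2, h4, fun e => ⟨h5 e, ?_⟩⟩
    rintro ⟨j, hj, rfl⟩
    exact (hR.walk_spec w h4).2 j (by omega)
  choose q hpath hlen hdart hedge using hq
  set S : Finset V := univ.filter fun x => x ≠ v ∧ l x = x with hS
  have htail : ∀ x, ∀ j < k x, p^[j] x ≠ v ∧ l (p^[j] x) = x := by
    intro x j hj
    have hjx := hj.trans_le (hkle x)
    refine ⟨fun h => ?_, (hk x j hjx).1 hj⟩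
    have := hR.depth_iterate j x
    rw [h, hR.depth_root] at this
    omega
  refine ⟨S.toList.map q, fun u => φ (l u) - φ u, ⟨?_, ?_, ?_⟩, ?_, ?_, ?_⟩
  · intro r hr
    obtain ⟨x, hx, rfl⟩ := List.mem_map.1 hr
    simp only [hS, Finset.mem_toList, Finset.mem_filter, Finset.mem_univ, true_and] at hx
    refine ⟨hpath x, ?_, hdart x⟩
    rw [hlen, hk x 0]
    · exact hx.2
    · exact Nat.pos_of_ne_zero fun h => hx.1 (hR.depth_eq_zero_iff.1 h)
  · rw [List.pairwise_map]
    refine S.nodup_toList.pairwise_of_forall_ne fun x _ y _ hxy e he he' => hxy ?_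
    obtain ⟨i, hi, rfl⟩ := (hedge x e).1 he
    obtain ⟨j, hj, hij⟩ := (hedge y _).1 he'
    obtain ⟨hi1, hi2⟩ := htail x i hi
    obtain ⟨hj1, hj2⟩ := htail y j hj
    rw [← hi2, ← hj2, hR.eq_of_edge_eq hi1 hj1 hij]
  · intro a b hab hφ
    have hpa : a ≠ v ∧ p a = b := by
      rcases hR.eq_parent_or a b hab with h | ⟨hb, h⟩
      · exact h
      · have := hR.depth_eq b hb
        rw [h] at this
        omega
    obtain ⟨hav, rfl⟩ := hpa
    refine ⟨q (l a), List.mem_map_of_mem (by simp [hS, hpos a hav, hll]), ?_⟩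
    rw [hedge]
    refine ⟨φ (l a) - φ a, ?_, by rw [hanc]⟩
    rw [hk _ _ (by have := hle a; omega), hanc]
  · intro c hc
    have h1 := hmax (l c) (1 + (φ (l c) - φ c))
    rw [Function.iterate_add_apply, hanc, Function.iterate_one] at h1
    have h2 := hR.depth_eq c hc
    have h3 := hle c
    beta_reduce
    omega
  · have hsum : pathsExtra (S.toList.map q) = ∑ x ∈ S, (2 ^ k x - 1) := by
      simp [pathsExtra, sysLengths, Function.comp_def, hlen, Finset.sum_map_toList]
    rw [hsum, ← Finset.sum_fiberwise_of_maps_to (s := univ.erase v) (t := S) (g := l)]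
    · refine Finset.sum_le_sum fun x _ => ?_
      have hgeom : ∑ j ∈ range (k x), 2 ^ j = 2 ^ k x - 1 := by
        simpa using Nat.geomSum_eq (le_refl 2) (k x)
      rw [← hgeom]
      have hinj : Set.InjOn (fun u => φ (l u) - φ u)
          (((univ.erase v).filter fun u => l u = x : Finset V) : Set V) := by
        intro a ha b hb hab
        simp only [Finset.coe_filter, Set.mem_ofPred_eq] at ha hb
        beta_reduce at hab
        rw [← hanc a, ← hanc b, hab, ha.2, hb.2]
      rw [← Finset.sum_image (f := fun j => 2 ^ j) hinj]
      refine Finset.sum_le_sum_of_subset fun j hj => ?_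
      obtain ⟨u, hu, rfl⟩ := Finset.mem_image.1 hj
      simp only [Finset.mem_filter, Finset.mem_erase] at hu
      obtain ⟨⟨huv, -⟩, rfl⟩ := hu
      have h0 : φ u ≠ 0 := fun h => huv (hR.depth_eq_zero_iff.1 h)
      rw [Finset.mem_range, hk _ _ (by have := hle u; omega), hanc]
    · intro u hu
      have huv : u ≠ v := by simpa using hu
      simp [hS, hpos u huv, hll]
  · beta_reduce
    rw [hR.depth_root, Nat.sub_zero]
    by_cases h0 : φ (l v) = 0
    · exact Or.inl h0
    · right
      have hlv : l v ≠ v := fun h => h0 (hR.depth_eq_zero_iff.2 h)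
      have hkv : k (l v) = φ (l v) := by
        by_contra hne
        have hlt : k (l v) < φ (l v) := lt_of_le_of_ne (hkle _) hne
        refine lt_irrefl _ ((hk _ _ hlt).2 ?_)
        have := hmono (p^[k (l v)] (l v)) (φ (l v) - k (l v)) (k (l v))
        rw [← Function.iterate_add_apply, Nat.sub_add_cancel hlt.le, hR.iterate_depth] at this
        exact this rfl
      refine List.mem_map.2 ⟨q (l v), List.mem_map_of_mem (by simp [hS, hlv, hll]), ?_⟩
      rw [hlen, hkv]

/-- `f_t(T, v)` is the maximum of `s_α` over all path partitions `α` of `T` rooted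
at `v`. -/
theorem t_pebbling_number_max_over_partitions (T : SimpleGraph V) [Fintype V]
    (hT : T.IsTree) (v : V) (t : ℕ) (ht : 1 ≤ t) :
    IsGreatest
      {s | ∃ P : PathSys T, IsPartitionTo T (fun u => T.dist u v) P ∧ s = sAlpha t P}
      (ftNum T v t) := by
  obtain ⟨p, hR⟩ := exists_isRooting hT v
  obtain ⟨P, h, hP, hh, hsum, hv⟩ := exists_partition_of_isRooting hR
  have hmem : sAlpha t P ∈
      {N | ∀ D : V → ℕ, (∑ x, D x) = N → ∃ D', PebReach T D D' ∧ t ≤ D' v} := by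
    intro D hD
    by_contra! hcon
    obtain ⟨F, hF, hFv⟩ := exists_isCert hR D hcon
    have h1 := hF.sum_le hh
    have h2 := le_sAlpha ht P hv
    have h3 : F v * 2 ^ h v ≤ (t - 1) * 2 ^ h v := Nat.mul_le_mul_right _ (by omega)
    omega
  have hlower : ∀ Q : PathSys T, IsPartitionTo T (fun u => T.dist u v) Q →
      sAlpha t Q ≤ ftNum T v t :=
    fun Q hQ => sAlpha_le_of_solvable hR ht hQ (Nat.sInf_mem ⟨_, hmem⟩)
  refine ⟨⟨P, hP, le_antisymm (Nat.sInf_le hmem) (hlower P hP)⟩, ?_⟩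
  rintro s ⟨Q, hQ, rfl⟩
  exact hlower Q hQ
end
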